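/- arXiv:0905.4336 — 9 statements merged into one kernel-verified Lean document; each statement's English description precedes it below -/
import Mathlib

section
/- Let l ≥ 3 be an integer and χ an odd Dirichlet character modulo l, with conductor f. Suppose r is a divisor of l with r > 1 which is NOT of the form f times a squarefree product of primes not dividing f (that is: f ∤ r, or r/f is not squarefree, or r/f is not coprime to f). Then ∑_{a∈(ℤ/lℤ)ˣ} χ(a)·exp(2πi·ã/r) = 0. -/
open scoped Classical

lemma aux_exp_eq (l r : ℕ) [NeZero l] [NeZero r] (hrl : r ∣ l) (a : (ZMod l)ˣ) :
    Complex.exp (2 * (Real.pi : ℂ) * Complex.I * (((a : ZMod l).val : ℂ)) / r)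
      = ZMod.stdAddChar ((ZMod.unitsMap hrl a : (ZMod r)ˣ) : ZMod r) := by
  have h : ((ZMod.unitsMap hrl a : (ZMod r)ˣ) : ZMod r) = (((a : ZMod l).val : ℤ) : ZMod r) := by
    rw [ZMod.unitsMap_val, ZMod.cast_eq_val]
    simp
  rw [h, ZMod.stdAddChar_coe]
  simp

lemma aux_shift (l r : ℕ) [NeZero l] [NeZero r] (hrl : r ∣ l) (χ : DirichletCharacter ℂ l)
    (u : (ZMod l)ˣ) :
    ∑ a : (ZMod l)ˣ, χ (a : ZMod l) *
        (ZMod.stdAddChar ((ZMod.unitsMap hrl a : (ZMod r)ˣ) : ZMod r) : ℂ)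
      = χ (u : ZMod l) * ∑ a : (ZMod l)ˣ, χ (a : ZMod l) *
        (ZMod.stdAddChar (((ZMod.unitsMap hrl a : (ZMod r)ˣ) : ZMod r) *
          ((ZMod.unitsMap hrl u : (ZMod r)ˣ) : ZMod r)) : ℂ) := by
  rw [← Equiv.sum_comp (Equiv.mulLeft u), Finset.mul_sum]
  refine Finset.sum_congr rfl fun a _ => ?_
  simp only [Equiv.coe_mulLeft, map_mul, Units.val_mul]
  rw [mul_comm ((ZMod.unitsMap hrl u : (ZMod r)ˣ) : ZMod r), mul_assoc]

lemma aux_prime (f r : ℕ) (hr : r ≠ 0) (hfr : f ∣ r)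
    (h : ¬ (Squarefree (r / f) ∧ Nat.Coprime (r / f) f)) :
    ∃ p m : ℕ, p.Prime ∧ r = m * p ∧ f ∣ m ∧ p ∣ m := by
  obtain ⟨k, rfl⟩ := hfr
  have hf : 0 < f := Nat.pos_of_ne_zero (left_ne_zero_of_mul hr)
  rw [Nat.mul_div_cancel_left _ hf] at h
  by_cases hc : Nat.Coprime k f
  · have hs : ¬ Squarefree k := fun hs => h ⟨hs, hc⟩
    rw [Nat.squarefree_iff_prime_squarefree] at hs
    push Not at hs
    obtain ⟨p, hp, q, rfl⟩ := hs
    exact ⟨p, f * (p * q), hp, by ring, Dvd.intro _ rfl, ⟨f * q, by ring⟩⟩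
  · obtain ⟨p, hp, ⟨q, rfl⟩, hpf⟩ := Nat.Prime.not_coprime_iff_dvd.mp hc
    exact ⟨p, f * q, hp, by ring, Dvd.intro _ rfl, hpf.mul_right _⟩

/-- Let `χ` be an odd Dirichlet character modulo `l ≥ 3`, with conductor `f`.  If `r ∣ l`,
`r > 1`, and `r` is NOT of the form `f` times a squarefree product of primes not dividing `f`
(that is: `f ∤ r`, or `r/f` is not squarefree, or `r/f` is not coprime to `f`), then
`∑_{a ∈ (ℤ/lℤ)ˣ} χ(a)·exp(2πi·ã/r) = 0`. -/
theorem sum_char_exp_eq_zero_of_not_divisor_form (l : ℕ) (hl : 3 ≤ l) [NeZero l]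
    (χ : DirichletCharacter ℂ l) (hχ : χ.Odd)
    (r : ℕ) (hrl : r ∣ l) (hr1 : 1 < r)
    (hrform : ¬ (χ.conductor ∣ r ∧ Squarefree (r / χ.conductor) ∧
      Nat.Coprime (r / χ.conductor) χ.conductor)) :
    ∑ a : (ZMod l)ˣ,
        χ (a : ZMod l) *
          Complex.exp (2 * (Real.pi : ℂ) * Complex.I * (((a : ZMod l).val : ℂ)) / r)
      = 0 := by
  haveI : NeZero r := ⟨by omega⟩
  simp_rw [aux_exp_eq l r hrl]
  by_cases hf : χ.conductor ∣ r
  · obtain ⟨p, m, hp, hrm, hfm, hpm⟩ := aux_prime χ.conductor r (by omega) hf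
      (fun h => hrform ⟨hf, h⟩)
    have hm0 : (m : ZMod r) ≠ 0 := by
      rw [Ne, ZMod.natCast_eq_zero_iff]
      intro h
      have hmpos : 0 < m := Nat.pos_of_ne_zero (by rintro rfl; omega)
      have := Nat.le_of_dvd hmpos h
      have := hp.two_le
      nlinarith
    have hmp : (m : ZMod r) * (p : ZMod r) = 0 := by
      rw [← Nat.cast_mul, ← hrm, ZMod.natCast_self]
    have hmm : (m : ZMod r) * (m : ZMod r) = 0 := by
      obtain ⟨q, hq⟩ := hpm
      have : (m : ZMod r) = p * q := by rw [hq]; push_cast; ring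
      calc (m : ZMod r) * (m : ZMod r) = (m * p) * q := by
            nth_rewrite 2 [this]; ring
        _ = 0 := by rw [hmp, zero_mul]
    set S : ℂ := ∑ a : (ZMod l)ˣ, χ (a : ZMod l) *
        (ZMod.stdAddChar ((ZMod.unitsMap hrl a : (ZMod r)ˣ) : ZMod r) : ℂ) with hS
    have key : ∀ j : ℕ, S = ∑ a : (ZMod l)ˣ, χ (a : ZMod l) *
        (ZMod.stdAddChar ((ZMod.unitsMap hrl a : (ZMod r)ˣ) : ZMod r) : ℂ) *
        (ZMod.stdAddChar (((ZMod.unitsMap hrl a : (ZMod r)ˣ) : ZMod r) * (m : ZMod r)) : ℂ) ^ j := by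
      intro j
      let v : (ZMod r)ˣ := ⟨1 + m * j, 1 - m * j, by linear_combination (-(j:ZMod r)^2) * hmm,
        by linear_combination (-(j:ZMod r)^2) * hmm⟩
      obtain ⟨u, hu⟩ := ZMod.unitsMap_surjective hrl v
      have hχu : χ (u : ZMod l) = 1 := by
        have h1 := (DirichletCharacter.factorsThrough_iff_ker_unitsMap
          χ.conductor_dvd_level).mp χ.factorsThrough_conductor
        have h2 : u ∈ (ZMod.unitsMap χ.conductor_dvd_level).ker := by
          rw [MonoidHom.mem_ker, ← ZMod.unitsMap_comp hf hrl, MonoidHom.comp_apply, hu]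
          ext
          have hmf : (m : ZMod χ.conductor) = 0 := (ZMod.natCast_eq_zero_iff _ _).mpr hfm
          have : ((ZMod.castHom hf (ZMod χ.conductor)) (1 + m * j : ZMod r)) = 1 := by
            simp [hmf, -ZMod.castHom_apply]
          rw [ZMod.unitsMap_val]
          simpa [v] using this
        have h3 := MonoidHom.mem_ker.mp (h1 h2)
        rw [← MulChar.coe_toUnitHom, h3, Units.val_one]
      rw [hS, aux_shift l r hrl χ u, hχu, one_mul, hu]
      refine Finset.sum_congr rfl fun a _ => ?_
      rw [mul_assoc, ← AddChar.map_nsmul_eq_pow, ← AddChar.map_add_eq_mul]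
      congr 2
      simp only [v, nsmul_eq_mul]
      ring
    have hsum : ∑ j ∈ Finset.range p, S = 0 := by
      rw [Finset.sum_congr rfl fun j _ => key j, Finset.sum_comm]
      refine Finset.sum_eq_zero fun a _ => ?_
      rw [← Finset.mul_sum]
      set w : ZMod r := ((ZMod.unitsMap hrl a : (ZMod r)ˣ) : ZMod r) * (m : ZMod r) with hw
      have hw0 : w ≠ 0 := by
        intro h
        exact hm0 ((Units.mul_right_eq_zero _).mp h)
      have hne : (ZMod.stdAddChar w : ℂ) ≠ 1 := by
        intro h
        apply hw0
        apply ZMod.injective_stdAddChar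
        rw [h, AddChar.map_zero_eq_one]
      have hpow : (ZMod.stdAddChar w : ℂ) ^ p = 1 := by
        rw [← AddChar.map_nsmul_eq_pow]
        have : p • w = 0 := by
          rw [nsmul_eq_mul, hw]
          linear_combination ((ZMod.unitsMap hrl a : (ZMod r)ˣ) : ZMod r) * hmp
        rw [this, AddChar.map_zero_eq_one]
      have hg := mul_geom_sum (ZMod.stdAddChar w : ℂ) p
      rw [hpow, sub_self] at hg
      rw [(mul_eq_zero.mp hg).resolve_left (sub_ne_zero.mpr hne), mul_zero]
    rw [Finset.sum_const, Finset.card_range, nsmul_eq_mul] at hsum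
    exact (mul_eq_zero.mp hsum).resolve_left (by exact_mod_cast hp.ne_zero)
  · have hnf : ¬ χ.FactorsThrough r := fun h =>
      hf (χ.conductor_dvd_of_mem_conductorSet h)
    rw [DirichletCharacter.factorsThrough_iff_ker_unitsMap hrl, SetLike.not_le_iff_exists] at hnf
    obtain ⟨u, hu, hu'⟩ := hnf
    have hne : χ (u : ZMod l) ≠ 1 := by
      intro h
      apply hu'
      rw [MonoidHom.mem_ker]
      ext
      rw [MulChar.coe_toUnitHom, h, Units.val_one]
    have h := aux_shift l r hrl χ u
    rw [MonoidHom.mem_ker.mp hu] at h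
    simp only [Units.val_one, mul_one] at h
    exact (mul_eq_zero.mp (show (χ (u : ZMod l) - 1) * _ = 0 by
      rw [sub_mul, one_mul, ← h, sub_self])).resolve_left (sub_ne_zero.mpr hne)
end

section
/- Let l ≥ 3 be an integer with l ≢ 2 (mod 4). In the complex group algebra ℂ[(ℤ/lℤ)ˣ] one has (i/(π·φ(l))) · ∑_{χ odd} L(1,χ) · ∑_{b∈(ℤ/lℤ)ˣ} χ⁻¹(b)·[b]⁻¹ = (1/(2l)) · ∑_{a∈(ℤ/lℤ)ˣ} ((1 + exp(2πi·ã/l))/(1 − exp(2πi·ã/l))) · [a]⁻¹, where the left-hand sum runs over all odd Dirichlet characters χ modulo l. -/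
open scoped Classical

open Filter Topology in
/-- Lipschitz-type bound for `x ↦ x ^ (-s)`. -/
lemma aux_rpow_diff (m x y s : ℝ) (hm : 0 < m) (hx : m ≤ x) (hy : m ≤ y) (hs : 0 < s) :
    ‖x ^ (-s) - y ^ (-s)‖ ≤ s * m ^ (-s - 1) * ‖x - y‖ := by
  refine Convex.norm_image_sub_le_of_norm_hasDerivWithin_le (f := fun t : ℝ => t ^ (-s))
    (f' := fun t => (-s) * t ^ (-s - 1)) (s := Set.Ici m) ?_ ?_ (convex_Ici m) hy hx
  · intro t ht
    have ht' : 0 < t := lt_of_lt_of_le hm ht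
    exact (Real.hasDerivAt_rpow_const (Or.inl ht'.ne')).hasDerivWithinAt
  · intro t ht
    have ht' : 0 < t := lt_of_lt_of_le hm ht
    rw [norm_mul, norm_neg, Real.norm_of_nonneg hs.le,
      Real.norm_of_nonneg (Real.rpow_nonneg ht'.le _)]
    exact mul_le_mul_of_nonneg_left
      (Real.rpow_le_rpow_of_nonpos hm ht (by linarith)) hs.le

/-- Dominating bound. -/
lemma aux_bound (a s : ℝ) (ha0 : 0 < a) (ha1 : a < 1) (hs1 : 1 ≤ s) (hs2 : s ≤ 2) (n : ℕ) :
    ‖((n + a : ℝ) ^ (-s) - (n + 1 - a : ℝ) ^ (-s))‖ ≤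
      (2 * (a * (1 - a)) ^ (-3 : ℝ)) * (1 / ((n : ℝ) + 1) ^ 2) := by
  set d := a * (1 - a) with hd
  have hd0 : 0 < d := mul_pos ha0 (by linarith)
  have hd1 : d ≤ 1 := by nlinarith
  have hn : (0 : ℝ) ≤ n := n.cast_nonneg
  have hda : d ≤ a := by nlinarith
  have hda' : d ≤ 1 - a := by nlinarith
  have hx : d * (n + 1) ≤ n + a := by nlinarith
  have hy : d * (n + 1) ≤ n + 1 - a := by nlinarith
  have hm : 0 < d * (n + 1) := by positivity
  refine (aux_rpow_diff _ _ _ s hm hx hy (by linarith)).trans ?_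
  have h1 : ‖(n + a : ℝ) - (n + 1 - a)‖ ≤ 1 := by
    rw [Real.norm_eq_abs, abs_le]; constructor <;> linarith
  have h2 : (d * (n + 1)) ^ (-s - 1) ≤ d ^ (-3 : ℝ) * (1 / ((n : ℝ) + 1) ^ 2) := by
    rw [Real.mul_rpow hd0.le (by positivity)]
    refine mul_le_mul ?_ ?_ (by positivity) (by positivity)
    · exact Real.rpow_le_rpow_of_exponent_ge hd0 hd1 (by linarith)
    · calc ((n : ℝ) + 1) ^ (-s - 1) ≤ ((n : ℝ) + 1) ^ (-2 : ℝ) :=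
            Real.rpow_le_rpow_of_exponent_le (by linarith) (by linarith)
        _ = 1 / ((n : ℝ) + 1) ^ 2 := by
            rw [Real.rpow_neg (by positivity), one_div]; norm_cast
  have h3 : 0 ≤ (d * (n + 1)) ^ (-s - 1) := by positivity
  calc s * (d * (n + 1)) ^ (-s - 1) * ‖(n + a : ℝ) - (n + 1 - a)‖
      ≤ s * (d * (n + 1)) ^ (-s - 1) * 1 := by gcongr
    _ ≤ 2 * (d * (n + 1)) ^ (-s - 1) := by nlinarith
    _ ≤ _ := by linarith

lemma aux_summable_bound (C : ℝ) : Summable fun n : ℕ => C * (1 / ((n : ℝ) + 1) ^ 2) := by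
  refine Summable.mul_left _ ?_
  have := (summable_nat_add_iff 1).mpr (Real.summable_one_div_nat_pow.mpr (one_lt_two))
  simpa using this

lemma aux_term (a s : ℝ) (ha0 : 0 < a) (ha1 : a < 1) (n : ℕ) :
    ((1 / (n + a : ℂ) ^ (s : ℂ) - 1 / (n + 1 - a : ℂ) ^ (s : ℂ)) / 2) =
    ((((n + a : ℝ) ^ (-s) - (n + 1 - a : ℝ) ^ (-s)) / 2 : ℝ) : ℂ) := by
  have hn : (0 : ℝ) ≤ n := n.cast_nonneg
  rw [Real.rpow_neg (by linarith), Real.rpow_neg (by linarith)]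
  push_cast
  rw [Complex.ofReal_cpow (by linarith), Complex.ofReal_cpow (by linarith)]
  push_cast
  simp only [one_div]

open Filter Topology HurwitzZeta in
lemma aux_hurwitz_tsum (a : ℝ) (ha0 : 0 < a) (ha1 : a < 1) :
    hurwitzZetaOdd (a : UnitAddCircle) 1 =
      ∑' n : ℕ, ((((n + a : ℝ) ^ (-1 : ℝ) - (n + 1 - a : ℝ) ^ (-1 : ℝ)) / 2 : ℝ) : ℂ) := by
  have hlim1 : Tendsto (fun s : ℝ => hurwitzZetaOdd (a : UnitAddCircle) (s : ℂ)) (𝓝[>] 1)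
      (𝓝 (hurwitzZetaOdd (a : UnitAddCircle) 1)) := by
    have hc : Continuous (fun s : ℝ => hurwitzZetaOdd (a : UnitAddCircle) (s : ℂ)) :=
      (differentiable_hurwitzZetaOdd (a : UnitAddCircle)).continuous.comp
        Complex.continuous_ofReal
    have := (hc.tendsto 1).mono_left (nhdsWithin_le_nhds (s := Set.Ioi 1))
    simpa using this
  refine tendsto_nhds_unique hlim1 ?_
  have hlim2 : Tendsto (fun s : ℝ =>
      ∑' n : ℕ, ((((n + a : ℝ) ^ (-s) - (n + 1 - a : ℝ) ^ (-s)) / 2 : ℝ) : ℂ)) (𝓝[>] 1)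
      (𝓝 (∑' n : ℕ, ((((n + a : ℝ) ^ (-1 : ℝ) - (n + 1 - a : ℝ) ^ (-1 : ℝ)) / 2 : ℝ) : ℂ))) := by
    refine tendsto_tsum_of_dominated_convergence
      (aux_summable_bound (2 * (a * (1 - a)) ^ (-3 : ℝ))) ?_ ?_
    · intro n
      have hn : (0 : ℝ) ≤ n := n.cast_nonneg
      have h1 : (n + a : ℝ) ≠ 0 := by linarith
      have h2 : (n + 1 - a : ℝ) ≠ 0 := by linarith
      have hc : Continuous (fun s : ℝ =>
          ((((n + a : ℝ) ^ (-s) - (n + 1 - a : ℝ) ^ (-s)) / 2 : ℝ) : ℂ)) := by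
        refine Complex.continuous_ofReal.comp (Continuous.div_const (Continuous.sub ?_ ?_) _)
        · exact (Real.continuous_const_rpow h1).comp continuous_neg
        · exact (Real.continuous_const_rpow h2).comp continuous_neg
      exact (hc.tendsto 1).mono_left nhdsWithin_le_nhds
    · have : Set.Ioc (1 : ℝ) 2 ∈ 𝓝[>] (1 : ℝ) := Ioc_mem_nhdsGT (by norm_num)
      filter_upwards [this] with s hs n
      rw [Complex.norm_real, norm_div]
      have := aux_bound a s ha0 ha1 hs.1.le hs.2 n
      refine le_trans ?_ this
      rw [Real.norm_ofNat]
      linarith [norm_nonneg ((n + a : ℝ) ^ (-s) - (n + 1 - a : ℝ) ^ (-s))]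
  refine hlim2.congr' ?_
  filter_upwards [self_mem_nhdsWithin] with s hs
  rw [← (hasSum_nat_hurwitzZetaOdd_of_mem_Icc (a := a) ⟨ha0.le, ha1.le⟩ (s := (s : ℂ))
    (by simpa using hs)).tsum_eq]
  exact tsum_congr fun n => (aux_term a s ha0 ha1 n).symm

open Filter Topology HurwitzZeta in
lemma aux_hurwitz_one (a : ℝ) (ha0 : 0 < a) (ha1 : a < 1) :
    hurwitzZetaOdd (a : UnitAddCircle) 1 = Real.pi / 2 * Complex.cot (Real.pi * a) := by
  rw [aux_hurwitz_tsum a ha0 ha1]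
  have hsum : Summable fun n : ℕ =>
      ((((n + a : ℝ) ^ (-1 : ℝ) - (n + 1 - a : ℝ) ^ (-1 : ℝ)) / 2 : ℝ) : ℂ) := by
    refine Summable.of_norm_bounded (aux_summable_bound (2 * (a * (1 - a)) ^ (-3 : ℝ))) ?_
    intro n
    rw [Complex.norm_real, norm_div]
    refine le_trans ?_ (aux_bound a 1 ha0 ha1 le_rfl (by norm_num) n)
    rw [Real.norm_ofNat]
    linarith [norm_nonneg ((n + a : ℝ) ^ (-1 : ℝ) - (n + 1 - a : ℝ) ^ (-1 : ℝ))]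
  refine tendsto_nhds_unique hsum.hasSum.tendsto_sum_nat ?_
  have hx : (a : ℂ) ∈ Complex.integerComplement := by
    rw [Complex.mem_integerComplement_iff]
    rintro ⟨n, hn⟩
    have hn' : (n : ℝ) = a := by exact_mod_cast hn
    rw [← hn'] at ha0 ha1
    have h1 : 0 < n := by exact_mod_cast ha0
    have h2 : n < 1 := by exact_mod_cast ha1
    omega
  have ht := tendsto_logDeriv_euler_cot_sub hx
  have h0 : Tendsto (fun N : ℕ => (1 : ℂ) / ((N : ℂ) + a)) atTop (𝓝 0) := by
    have : Tendsto (fun N : ℕ => (1 : ℝ) / ((N : ℝ) + a)) atTop (𝓝 0) := by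
      simp only [one_div]
      exact tendsto_inv_atTop_zero.comp
        (tendsto_atTop_add_const_right _ _ tendsto_natCast_atTop_atTop)
    have h := (Complex.continuous_ofReal.tendsto 0).comp this
    simpa [Function.comp_def] using h
  have key := ((ht.add_const (1 / (a : ℂ))).sub h0).div_const 2
  have e : ((Real.pi * Complex.cot (Real.pi * a) - 1 / (a : ℂ)) + 1 / (a : ℂ) - 0) / 2
      = Real.pi / 2 * Complex.cot (Real.pi * a) := by ring
  rw [e] at key
  refine key.congr fun N => ?_
  induction N with
  | zero => simp
  | succ N ih =>
    rw [Finset.sum_range_succ, Finset.sum_range_succ, ← ih]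
    have hn : (0 : ℝ) ≤ N := N.cast_nonneg
    rw [Real.rpow_neg_one, Real.rpow_neg_one]
    have h3 : ((a : ℂ) - (N + 1)) = -((N : ℂ) + 1 - a) := by ring
    have h4 : ((N : ℂ) + 1) + a = a + (N + 1) := by ring
    unfold cotTerm
    push_cast
    rw [h3, h4, one_div (-((N : ℂ) + 1 - a)), inv_neg]
    ring

open HurwitzZeta in
lemma aux_zmod (l : ℕ) (hl : 3 ≤ l) [NeZero l] (b : (ZMod l)ˣ) :
    Complex.I / Real.pi * hurwitzZetaOdd (ZMod.toAddCircle (b : ZMod l)) 1 =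
      1 / 2 * ((1 + Complex.exp (2 * (Real.pi : ℂ) * Complex.I * (((b : ZMod l).val : ℂ)) / l)) /
      (1 - Complex.exp (2 * (Real.pi : ℂ) * Complex.I * (((b : ZMod l).val : ℂ)) / l))) := by
  have hl0 : (0 : ℝ) < l := by positivity
  haveI : Fact (1 < l) := ⟨by omega⟩
  have hb : 0 < (b : ZMod l).val := by
    rw [Nat.pos_iff_ne_zero, Ne, ZMod.val_eq_zero]
    exact b.ne_zero
  have hb' := ZMod.val_lt (b : ZMod l)
  rw [ZMod.toAddCircle_apply, aux_hurwitz_one, Complex.cot_pi_eq_exp_ratio]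
  · push_cast
    rw [mul_div_assoc]
    have hpi : (Real.pi : ℂ) ≠ 0 := by exact_mod_cast Real.pi_ne_zero
    generalize Complex.exp _ = z
    rw [add_comm z 1, mul_comm Complex.I (1 - z), ← div_div, div_eq_mul_inv _ Complex.I]
    have hI := Complex.I_ne_zero
    field_simp
  · have : (0 : ℝ) < (b : ZMod l).val := by exact_mod_cast hb
    positivity
  · rw [div_lt_one hl0]; exact_mod_cast hb'

open HurwitzZeta in
lemma aux_coeff (l : ℕ) (hl : 3 ≤ l) [NeZero l] (b : (ZMod l)ˣ) :
    (∑ χ : DirichletCharacter ℂ l,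
        if χ.Odd then DirichletCharacter.LFunction χ 1 * χ⁻¹ (b : ZMod l) else 0) =
      (Nat.totient l : ℂ) / l * hurwitzZetaOdd (ZMod.toAddCircle (b : ZMod l)) 1 := by
  set h : ZMod l → ℂ := fun j => hurwitzZetaOdd (ZMod.toAddCircle j) 1 with hh
  have hneg : ∀ j, h (-j) = - h j := fun j => by
    simp only [hh, map_neg, hurwitzZetaOdd_neg]
  have hinv : ∀ χ : DirichletCharacter ℂ l, χ⁻¹ (b : ZMod l) = χ ((b : ZMod l)⁻¹) := fun χ => by
    rw [MulChar.inv_apply, ZMod.inv_coe_unit, Ring.inverse_unit]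
  have hterm : ∀ χ : DirichletCharacter ℂ l,
      (if χ.Odd then DirichletCharacter.LFunction χ 1 * χ⁻¹ (b : ZMod l) else 0) =
      ∑ j : ZMod l, (χ ((b : ZMod l)⁻¹) * χ j - χ ((b : ZMod l)⁻¹) * χ (-j)) * (h j / (2 * l)) := by
    intro χ
    rw [hinv]
    split_ifs with ho
    · rw [DirichletCharacter.LFunction, ZMod.LFunction_def_odd ho.to_fun, Complex.cpow_neg_one,
        Finset.mul_sum, Finset.sum_mul]
      refine Finset.sum_congr rfl fun j _ => ?_
      rw [ho.eval_neg]
      simp only [hh]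
      have : (l : ℂ) ≠ 0 := NeZero.ne _
      field_simp
      ring
    · have he := χ.even_or_odd.resolve_right ho
      symm
      refine Finset.sum_eq_zero fun j _ => ?_
      rw [he.eval_neg]
      ring
  rw [Finset.sum_congr rfl fun χ _ => hterm χ, Finset.sum_comm]
  simp_rw [← Finset.sum_mul, Finset.sum_sub_distrib,
    DirichletCharacter.sum_char_inv_mul_char_eq ℂ b.isUnit, sub_mul]
  rw [Finset.sum_sub_distrib]
  have e1 : (∑ j : ZMod l, (if (b : ZMod l) = j then (Nat.totient l : ℂ) else 0) * (h j / (2 * l)))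
      = Nat.totient l * (h b / (2 * l)) := by
    simp [ite_mul]
  have e2 : (∑ j : ZMod l, (if (b : ZMod l) = -j then (Nat.totient l : ℂ) else 0) * (h j / (2 * l)))
      = Nat.totient l * (h (-b) / (2 * l)) := by
    have : ∀ j : ZMod l, ((b : ZMod l) = -j) = (-(b : ZMod l) = j) := fun j => by
      rw [neg_eq_iff_eq_neg]
    simp [ite_mul, this]
  rw [e1, e2, hneg]
  ring

/-- For an integer `l ≥ 3` with `l ≢ 2 (mod 4)`, in `ℂ[(ℤ/lℤ)ˣ]` one has
`(i/(π·φ(l))) · ∑_{χ odd} L(1,χ) · ∑_b χ⁻¹(b)·[b]⁻¹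
  = (1/(2l)) · ∑_a ((1 + exp(2πi·ã/l))/(1 - exp(2πi·ã/l))) · [a]⁻¹`. -/
theorem equivariant_L_value_formula (l : ℕ) (hl : 3 ≤ l) (hl4 : l % 4 ≠ 2) [NeZero l] :
    (Complex.I / ((Real.pi : ℂ) * (Nat.totient l : ℂ))) •
      ∑ χ : DirichletCharacter ℂ l,
        (if χ.Odd then
          (DirichletCharacter.LFunction χ 1) •
            ∑ b : (ZMod l)ˣ, MonoidAlgebra.single b⁻¹ (χ⁻¹ ((b : ZMod l)))
        else 0)
    = ((1 : ℂ) / (2 * l)) •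
        ∑ a : (ZMod l)ˣ,
          MonoidAlgebra.single a⁻¹
            ((1 + Complex.exp (2 * (Real.pi : ℂ) * Complex.I * (((a : ZMod l).val : ℂ)) / l)) /
              (1 - Complex.exp (2 * (Real.pi : ℂ) * Complex.I * (((a : ZMod l).val : ℂ)) / l))) := by
  have hterm : ∀ χ : DirichletCharacter ℂ l,
      (if χ.Odd then
          (DirichletCharacter.LFunction χ 1) •
            ∑ b : (ZMod l)ˣ, MonoidAlgebra.single b⁻¹ (χ⁻¹ ((b : ZMod l)))
        else 0) = ∑ b : (ZMod l)ˣ, (MonoidAlgebra.single b⁻¹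
          (if χ.Odd then DirichletCharacter.LFunction χ 1 * χ⁻¹ (b : ZMod l) else 0) :
            MonoidAlgebra ℂ (ZMod l)ˣ) := by
    intro χ
    split_ifs with ho
    · rw [Finset.smul_sum]
      refine Finset.sum_congr rfl fun b _ => ?_
      rw [MonoidAlgebra.smul_single, smul_eq_mul]
    · simp
  have hsingle : ∀ b : (ZMod l)ˣ, (∑ χ : DirichletCharacter ℂ l, (MonoidAlgebra.single b⁻¹
          (if χ.Odd then DirichletCharacter.LFunction χ 1 * χ⁻¹ (b : ZMod l) else 0) :
            MonoidAlgebra ℂ (ZMod l)ˣ)) = MonoidAlgebra.single b⁻¹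
        (∑ χ : DirichletCharacter ℂ l,
          if χ.Odd then DirichletCharacter.LFunction χ 1 * χ⁻¹ (b : ZMod l) else 0) := fun b =>
    (map_sum (MonoidAlgebra.singleAddHom b⁻¹) _ _).symm
  rw [Finset.sum_congr rfl fun χ _ => hterm χ, Finset.sum_comm, Finset.smul_sum, Finset.smul_sum]
  refine Finset.sum_congr rfl fun b _ => ?_
  rw [hsingle, MonoidAlgebra.smul_single, MonoidAlgebra.smul_single, aux_coeff l hl b]
  congr 1
  have hz := aux_zmod l hl b
  have hl0 : (l : ℂ) ≠ 0 := NeZero.ne _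
  have ht : (Nat.totient l : ℂ) ≠ 0 := by
    exact_mod_cast (Nat.totient_pos.mpr (by omega)).ne'
  have hpi : (Real.pi : ℂ) ≠ 0 := by exact_mod_cast Real.pi_ne_zero
  rw [smul_eq_mul, smul_eq_mul]
  calc _ = 1 / (l : ℂ) * (Complex.I / Real.pi *
        HurwitzZeta.hurwitzZetaOdd (ZMod.toAddCircle (b : ZMod l)) 1) := by
        field_simp
    _ = _ := by rw [hz]; ring
end

section
/- Let p be an odd prime and n ≥ 0 an integer. In the complex group algebra ℂ[(ℤ/p^{n+1}ℤ)ˣ] one has (i/(π·φ(p^{n+1}))) · ∑_{χ odd} L(1,χ) · ∑_{b∈(ℤ/p^{n+1}ℤ)ˣ} χ⁻¹(b)·[b] = θ_{p^{n+1}} · ∑_{a∈(ℤ/p^{n+1}ℤ)ˣ} ( (1/p^{n+1}) · ∑_{i=0}^{n} exp(2πi·ã/p^{i+1}) ) · [a], where the left-hand sum runs over all odd Dirichlet characters χ modulo p^{n+1}. -/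
open scoped Classical

/-- The Stickelberger element `θ_r = -∑_{a ∈ (ℤ/rℤ)ˣ} (ã/r - 1/2)·[a]⁻¹` in the complex
group algebra of `(ℤ/rℤ)ˣ`. -/
noncomputable def stickelbergerElt (r : ℕ) [NeZero r] : MonoidAlgebra ℂ (ZMod r)ˣ :=
  -∑ a : (ZMod r)ˣ, MonoidAlgebra.single a⁻¹ ((((a : ZMod r).val : ℂ) / r - 1 / 2))

namespace EquivL
open Complex Filter Topology Set MeasureTheory

/-- kernel whose Mellin transform is `Γ(s)` times the periodic zeta function -/
noncomputable def ker (z : ℂ) (t : ℝ) : ℂ := z * (Real.exp (-t) : ℂ) / (1 - z * (Real.exp (-t) : ℂ))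

lemma re_lt (z : ℂ) (_hz : ‖z‖ = 1) (hz1 : z.re < 1) (t : ℝ) (ht : 0 ≤ t) :
    (z * (Real.exp (-t) : ℂ)).re < 1 := by
  rw [Complex.re_mul_ofReal]
  have h1 : Real.exp (-t) ≤ 1 := by simpa using ht
  have h0 : 0 < Real.exp (-t) := Real.exp_pos _
  rcases le_or_gt z.re 0 with h | h
  · nlinarith
  · nlinarith

lemma slit (z : ℂ) (hz : ‖z‖ = 1) (hz1 : z.re < 1) (t : ℝ) (ht : 0 ≤ t) :
    1 - z * (Real.exp (-t) : ℂ) ∈ slitPlane := by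
  left
  have := re_lt z hz hz1 t ht
  simp only [sub_re, one_re]; linarith

lemma ker_contOn (z : ℂ) (hz : ‖z‖ = 1) (hz1 : z.re < 1) : ContinuousOn (ker z) (Ici 0) := by
  unfold ker
  apply ContinuousOn.div (by fun_prop) (by fun_prop)
  intro t ht
  exact slitPlane_ne_zero (slit z hz hz1 t ht)

lemma ker_top (z : ℂ) (hz : ‖z‖ = 1) :
    ker z =O[atTop] fun t : ℝ => Real.exp (-(1 : ℝ) * t) := by
  apply Asymptotics.IsBigO.of_bound 2
  have : ∀ᶠ t : ℝ in atTop, Real.exp (-t) < 1 / 2 :=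
    (Real.tendsto_exp_neg_atTop_nhds_zero).eventually_lt_const (by norm_num)
  filter_upwards [this] with t ht
  have h0 : 0 < Real.exp (-t) := Real.exp_pos _
  have hn : ‖z * (Real.exp (-t) : ℂ)‖ = Real.exp (-t) := by
    rw [norm_mul, hz, one_mul, norm_real, Real.norm_eq_abs, abs_of_pos h0]
  have h2 : 1 / 2 ≤ ‖1 - z * (Real.exp (-t) : ℂ)‖ := by
    have := norm_sub_norm_le 1 (z * (Real.exp (-t) : ℂ))
    rw [hn, norm_one] at this
    linarith
  rw [ker, norm_div, hn, neg_one_mul, Real.norm_eq_abs, abs_of_pos h0, div_le_iff₀ (by linarith)]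
  nlinarith

lemma ker_bot (z : ℂ) (hz : ‖z‖ = 1) (hz1 : z.re < 1) :
    ker z =O[𝓝[>] 0] fun t : ℝ => t ^ (-(0 : ℝ)) := by
  simp only [neg_zero, Real.rpow_zero]
  have h : Tendsto (ker z) (𝓝[>] 0) (𝓝 (ker z 0)) :=
    ((ker_contOn z hz hz1) 0 self_mem_Ici).mono_left (nhdsWithin_mono _ Ioi_subset_Ici_self)
  exact h.isBigO_one ℝ

lemma ker_li (z : ℂ) (hz : ‖z‖ = 1) (hz1 : z.re < 1) : LocallyIntegrableOn (ker z) (Ioi 0) :=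
  ((ker_contOn z hz hz1).mono Ioi_subset_Ici_self).locallyIntegrableOn measurableSet_Ioi

lemma mellin_ker_one (z : ℂ) (hz : ‖z‖ = 1) (hz1 : z.re < 1) :
    mellin (ker z) 1 = - log (1 - z) := by
  have hc : MellinConvergent (ker z) 1 := mellinConvergent_of_isBigO_rpow_exp one_pos
    (ker_li z hz hz1) (ker_top z hz) (ker_bot z hz hz1) (by simp)
  have hi : IntegrableOn (ker z) (Ioi 0) := by
    simpa [MellinConvergent] using hc
  have hlim : Tendsto (fun t : ℝ => log (1 - z * (Real.exp (-t) : ℂ))) atTop (𝓝 0) := by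
    have h1 : Tendsto (fun t : ℝ => 1 - z * (Real.exp (-t) : ℂ)) atTop (𝓝 (1 - z * ((0:ℝ):ℂ))) :=
      tendsto_const_nhds.sub (tendsto_const_nhds.mul
        ((continuous_ofReal.tendsto 0).comp Real.tendsto_exp_neg_atTop_nhds_zero))
    have := h1.clog (by simp)
    simpa using this
  have := integral_Ioi_of_hasDerivAt_of_tendsto' (a := 0)
    (f := fun t : ℝ => log (1 - z * (Real.exp (-t) : ℂ))) (f' := ker z) ?_ hi hlim
  · simp [mellin, this]
  · intro t ht
    have h1 : HasDerivAt (fun t : ℝ => 1 - z * (Real.exp (-t) : ℂ)) (z * (Real.exp (-t) : ℂ)) t := by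
      have h3 := ((Real.hasDerivAt_exp (-t)).comp t (hasDerivAt_neg t)).ofReal_comp
      have h4 := (h3.const_mul z).const_sub 1
      have h5 : -(z * ((Real.exp (-t) * -1 : ℝ) : ℂ)) = z * (Real.exp (-t) : ℂ) := by
        push_cast; ring
      rw [h5] at h4
      exact h4
    exact h1.clog_real (slit z hz hz1 t ht)

lemma expZeta_eq (x : ℝ) {s : ℂ} (hs : 1 < s.re) :
    mellin (ker (cexp (2 * Real.pi * I * x))) s = Gamma s * HurwitzZeta.expZeta x s := by
  set z := cexp (2 * Real.pi * I * x) with hzdef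
  have hz : ‖z‖ = 1 := by
    rw [hzdef, show (2 * Real.pi * I * x : ℂ) = ((2 * Real.pi * x : ℝ) : ℂ) * I by push_cast; ring]
    exact norm_exp_ofReal_mul_I _
  have hs0 : s ≠ 0 := by rintro rfl; simp at hs; linarith
  have h1 := (HurwitzZeta.hasSum_expZeta_of_one_lt_re x hs)
  rw [← hasSum_nat_add_iff' 1] at h1
  simp only [Finset.range_one, Finset.sum_singleton, Nat.cast_zero, zero_cpow hs0, div_zero,
    sub_zero] at h1
  have h2 := h1.mul_left (Gamma s)
  have h3 := hasSum_mellin (a := fun n : ℕ => z ^ (n + 1)) (p := fun n : ℕ => (n + 1 : ℝ))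
    (F := ker z) (s := s) (fun i => Or.inr (by positivity)) (by linarith) ?_ ?_
  · refine h3.unique (h2.congr_fun ?_)
    intro n
    rw [hzdef, ← Complex.exp_nat_mul]
    push_cast
    rw [mul_div_assoc]
    congr 3
    ring
  · intro t ht
    have hn : ‖z * (Real.exp (-t) : ℂ)‖ < 1 := by
      rw [norm_mul, hz, one_mul, norm_real, Real.norm_eq_abs, abs_of_pos (Real.exp_pos _)]
      simpa using ht
    have := (hasSum_geometric_of_norm_lt_one hn).mul_left (z * (Real.exp (-t) : ℂ))
    rw [← div_eq_mul_inv] at this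
    refine this.congr_fun ?_
    intro n
    rw [← pow_succ', mul_pow, ← ofReal_pow, ← Real.exp_nat_mul]
    push_cast
    congr 2
    ring
  · simp only [norm_pow, hz, one_pow]
    have := (summable_nat_add_iff 1).mpr (Real.summable_one_div_nat_rpow.mpr hs)
    simpa using this

lemma re_exp_lt (x : ℝ) (hx0 : 0 < x) (hx1 : x < 1) : (cexp (2 * Real.pi * I * x)).re < 1 := by
  rw [show (2 * Real.pi * I * x : ℂ) = ((2 * Real.pi * x : ℝ) : ℂ) * I by push_cast; ring,
    exp_ofReal_mul_I_re]
  have h1 : Real.cos (2 * Real.pi * x) = 1 - 2 * Real.sin (Real.pi * x) ^ 2 := by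
    rw [mul_assoc, Real.cos_two_mul, Real.cos_sq']; ring
  have h2 : 0 < Real.sin (Real.pi * x) :=
    Real.sin_pos_of_pos_of_lt_pi (by positivity) (by nlinarith [Real.pi_pos])
  rw [h1]; nlinarith

lemma expZeta_one (x : ℝ) (hx0 : 0 < x) (hx1 : x < 1) :
    HurwitzZeta.expZeta x 1 = - log (1 - cexp (2 * Real.pi * I * x)) := by
  set z := cexp (2 * Real.pi * I * x) with hzdef
  have hz : ‖z‖ = 1 := by
    rw [hzdef, show (2 * Real.pi * I * x : ℂ) = ((2 * Real.pi * x : ℝ) : ℂ) * I by push_cast; ring]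
    exact norm_exp_ofReal_mul_I _
  have hz1 : z.re < 1 := re_exp_lt x hx0 hx1
  have hx : (x : UnitAddCircle) ≠ 0 := by
    intro h
    rw [AddCircle.coe_eq_zero_iff] at h
    obtain ⟨n, hn⟩ := h
    simp at hn
    rw [← hn] at hx0 hx1
    have h0 : (0 : ℤ) < n := by exact_mod_cast hx0
    have h1 : n < (1 : ℤ) := by exact_mod_cast hx1
    omega
  rw [← mellin_ker_one z hz hz1]
  have hc : ContinuousAt (mellin (ker z)) 1 := (mellin_differentiableAt_of_isBigO_rpow_exp one_pos
    (ker_li z hz hz1) (ker_top z hz) (ker_bot z hz hz1) (by simp)).continuousAt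
  have hg : ContinuousAt (fun s => Gamma s * HurwitzZeta.expZeta x s) 1 := by
    refine ContinuousAt.mul (differentiableAt_Gamma_one).continuousAt
      (HurwitzZeta.differentiable_expZeta_of_ne_zero hx).continuous.continuousAt
  have hpath : Tendsto (fun t : ℝ => (t : ℂ)) (𝓝[>] 1) (𝓝 1) :=
    (continuous_ofReal.tendsto 1).mono_left nhdsWithin_le_nhds
  have e := tendsto_nhds_unique_of_eventuallyEq (hc.tendsto.comp hpath) (hg.tendsto.comp hpath) (by
    filter_upwards [self_mem_nhdsWithin] with t ht
    exact expZeta_eq x (by simpa using ht))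
  simpa using e.symm

lemma sinZeta_one (x : ℝ) (hx0 : 0 < x) (hx1 : x < 1) :
    HurwitzZeta.expZeta (x : UnitAddCircle) 1 - HurwitzZeta.expZeta (-(x : UnitAddCircle)) 1
      = 2 * Real.pi * I * (1 / 2 - x) := by
  have hneg : (-(x : UnitAddCircle)) = ((1 - x : ℝ) : UnitAddCircle) := by
    rw [AddCircle.coe_sub, AddCircle.coe_period]; simp
  rw [hneg, expZeta_one x hx0 hx1, expZeta_one (1 - x) (by linarith) (by linarith)]
  have e1 : cexp (2 * Real.pi * I * ((1 - x : ℝ) : ℂ)) =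
      (starRingEnd ℂ) (cexp (2 * Real.pi * I * x)) := by
    rw [← exp_conj]
    push_cast
    rw [mul_sub, mul_one, exp_sub, exp_two_pi_mul_I, one_div, ← exp_neg]
    simp [Complex.conj_ofNat]
  have hsl : (1 - cexp (2 * Real.pi * I * x)) ∈ slitPlane := by
    left
    have := re_exp_lt x hx0 hx1
    simp only [sub_re, one_re]; linarith
  have e2 : (1 : ℂ) - (starRingEnd ℂ) (cexp (2 * Real.pi * I * x)) =
      (starRingEnd ℂ) (1 - cexp (2 * Real.pi * I * x)) := by simp
  rw [e1, e2, log_conj _ (slitPlane_arg_ne_pi hsl)]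
  have harg : (1 - cexp (2 * Real.pi * I * x)).arg = Real.pi * (x - 1 / 2) := by
    have h2 : 0 < Real.sin (Real.pi * x) :=
      Real.sin_pos_of_pos_of_lt_pi (by positivity) (by nlinarith [Real.pi_pos])
    have : 1 - cexp (2 * Real.pi * I * x) = ((2 * Real.sin (Real.pi * x) : ℝ) : ℂ) *
        (cos ((Real.pi * (x - 1 / 2) : ℝ) : ℂ) + sin ((Real.pi * (x - 1 / 2) : ℝ) : ℂ) * I) := by
      rw [show (2 * Real.pi * I * x : ℂ) = (2 * ((Real.pi * x : ℝ) : ℂ)) * I by push_cast; ring,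
        exp_mul_I, cos_two_mul', sin_two_mul,
        show Real.pi * (x - 1 / 2) = Real.pi * x - Real.pi / 2 by ring,
        ← ofReal_cos (_ - _), ← ofReal_sin (_ - _),
        Real.cos_sub_pi_div_two, Real.sin_sub_pi_div_two]
      push_cast
      have := sin_sq_add_cos_sq ((Real.pi : ℂ) * x)
      linear_combination -this
    rw [this, arg_mul_cos_add_sin_mul_I (by positivity)]
    constructor <;> nlinarith [Real.pi_pos]
  have := sub_conj (log (1 - cexp (2 * Real.pi * I * x)))
  rw [log_im, harg] at this
  push_cast at this
  linear_combination -this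

/-- sawtooth function on `ZMod N` -/
noncomputable def saw (N : ℕ) (j : ZMod N) : ℂ := if j = 0 then 0 else (j.val : ℂ) / N - 1 / 2

lemma saw_neg (N : ℕ) [NeZero N] (j : ZMod N) : saw N (-j) = - saw N j := by
  unfold saw
  by_cases h : j = 0
  · simp [h]
  · have hN : (N : ℂ) ≠ 0 := NeZero.ne _
    rw [if_neg h, if_neg (by simpa using h), ZMod.neg_val, if_neg h,
      Nat.cast_sub (ZMod.val_lt j).le]
    field_simp
    ring

/-- Fourier transform of the sawtooth function -/
noncomputable def sawF (N : ℕ) [NeZero N] (c : ZMod N) : ℂ :=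
  ∑ j : ZMod N, saw N j * ZMod.stdAddChar (c * j)

lemma sawF_neg (N : ℕ) [NeZero N] (c : ZMod N) : sawF N (-c) = - sawF N c := by
  unfold sawF
  rw [← Equiv.sum_comp (Equiv.neg (ZMod N)), ← Finset.sum_neg_distrib]
  refine Finset.sum_congr rfl fun j _ => ?_
  simp [saw_neg]

open ZMod in
lemma LFunction_one_odd (N : ℕ) [NeZero N] (χ : DirichletCharacter ℂ N) (hχ : χ.Odd) :
    I / Real.pi * DirichletCharacter.LFunction χ 1 = -(1 / (N : ℂ)) * ∑ c : ZMod N, χ c * sawF N c := by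
  have hN : (N : ℂ) ≠ 0 := NeZero.ne _
  have hodd : ∀ c : ZMod N, χ (-c) = - χ c := fun c => by
    rw [← neg_one_mul, map_mul, show χ (-1) = -1 from hχ, neg_one_mul]
  set Φ : ZMod N → ℂ := fun j => (N : ℂ)⁻¹ * ∑ c : ZMod N, stdAddChar (c * j) * χ c with hΦ
  have hΦodd : ∀ j, Φ (-j) = - Φ j := by
    intro j
    simp only [hΦ]
    rw [← mul_neg, ← Equiv.sum_comp (Equiv.neg (ZMod N)), ← Finset.sum_neg_distrib]
    congr 1
    refine Finset.sum_congr rfl fun c _ => ?_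
    simp [hodd]
  have hΦ0 : Φ 0 = 0 := by
    have := hΦodd 0
    rw [neg_zero] at this
    exact self_eq_neg.mp this
  have hdft : ZMod.dft Φ = χ := by
    have : Φ = ZMod.dft.symm (χ : ZMod N → ℂ) := by
      ext j
      rw [ZMod.invDFT_apply]; simp [hΦ]
    rw [this, LinearEquiv.apply_symm_apply]
  have hL : DirichletCharacter.LFunction χ 1 =
      ∑ j : ZMod N, Φ j * HurwitzZeta.expZeta (toAddCircle (-j)) 1 := by
    rw [DirichletCharacter.LFunction, ← hdft, ZMod.LFunction_dft Φ (Or.inl hΦ0)]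
  have hL2 : DirichletCharacter.LFunction χ 1 =
      - ∑ j : ZMod N, Φ j * HurwitzZeta.expZeta (toAddCircle j) 1 := by
    rw [hL, ← Equiv.sum_comp (Equiv.neg (ZMod N)), ← Finset.sum_neg_distrib]
    refine Finset.sum_congr rfl fun c _ => ?_
    simp [hΦodd]
  have hsum : 2 * DirichletCharacter.LFunction χ 1 =
      ∑ j : ZMod N, Φ j * (2 * Real.pi * I * saw N j) := by
    rw [two_mul]
    nth_rewrite 1 [hL]
    rw [hL2, ← sub_eq_add_neg, ← Finset.sum_sub_distrib]
    refine Finset.sum_congr rfl fun j _ => ?_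
    rw [← mul_sub]
    by_cases hj : j = 0
    · simp [hj, hΦ0]
    congr 1
    have hN0 : (0 : ℝ) < N := Nat.cast_pos.mpr (NeZero.pos N)
    have h := sinZeta_one (j.val / N : ℝ)
      (div_pos (Nat.cast_pos.mpr (Nat.pos_of_ne_zero ((ZMod.val_ne_zero j).mpr hj))) hN0)
      ((div_lt_one hN0).mpr (Nat.cast_lt.mpr (ZMod.val_lt j)))
    rw [← toAddCircle_apply, ← map_neg] at h
    rw [saw, if_neg hj]
    push_cast at h
    linear_combination -h
  have hswap : ∑ j : ZMod N, Φ j * saw N j = (N : ℂ)⁻¹ * ∑ c : ZMod N, χ c * sawF N c := by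
    simp only [hΦ, sawF, Finset.mul_sum, Finset.sum_mul]
    rw [Finset.sum_comm]
    refine Finset.sum_congr rfl fun c _ => Finset.sum_congr rfl fun j _ => ?_
    ring
  have hfin : DirichletCharacter.LFunction χ 1 =
      Real.pi * I * ((N : ℂ)⁻¹ * ∑ c : ZMod N, χ c * sawF N c) := by
    rw [← hswap, Finset.mul_sum]
    have : ∑ j : ZMod N, Φ j * (2 * Real.pi * I * saw N j) =
        2 * ∑ j : ZMod N, Real.pi * I * (Φ j * saw N j) := by
      rw [Finset.mul_sum]
      refine Finset.sum_congr rfl fun j _ => ?_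
      ring
    rw [this] at hsum
    exact mul_left_cancel₀ two_ne_zero hsum
  rw [hfin]
  have hpi : (Real.pi : ℂ) ≠ 0 := by exact_mod_cast Real.pi_ne_zero
  field_simp
  rw [I_sq, neg_one_mul]

/-! ### the combinatorial identity -/

lemma sum_range_mul' (f : ℕ → ℂ) (M q : ℕ) :
    ∑ a ∈ Finset.range (M * q), f a = ∑ k ∈ Finset.range q, ∑ a ∈ Finset.range M, f (M * k + a) := by
  induction q with
  | zero => simp
  | succ q ih => rw [Nat.mul_succ, Finset.sum_range_add, ih, Finset.sum_range_succ]

noncomputable def UU (p m i c : ℕ) : ℂ := ∑ a ∈ Finset.range (p ^ m),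
  if p ∣ a then 0 else ((a : ℂ) / p ^ m - 1 / 2) * cexp (2 * Real.pi * I * (a * c) / p ^ (i + 1))

noncomputable def SS (p m c : ℕ) : ℂ := ∑ a ∈ Finset.range (p ^ m),
  if a = 0 then 0 else ((a : ℂ) / p ^ m - 1 / 2) * cexp (2 * Real.pi * I * (a * c) / p ^ m)

lemma exp_period (x y N : ℕ) (hN : N ≠ 0) (h : x ≡ y [MOD N]) :
    cexp (2 * Real.pi * I * x / N) = cexp (2 * Real.pi * I * y / N) := by
  have hN' : (N : ℂ) ≠ 0 := by exact_mod_cast hN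
  rw [Complex.exp_eq_exp_iff_exists_int]
  obtain ⟨k, hk⟩ := (Nat.modEq_iff_dvd.mp h.symm)
  refine ⟨k, ?_⟩
  have : (x : ℂ) - y = N * k := by exact_mod_cast hk
  field_simp
  linear_combination this

lemma UU_succ (p m i c : ℕ) (hp : p ≠ 0) (hi : i + 1 ≤ m) : UU p (m + 1) i c = UU p m i c := by
  have hp' : (p : ℂ) ≠ 0 := by exact_mod_cast hp
  unfold UU
  rw [pow_succ, sum_range_mul', Finset.sum_comm]
  refine Finset.sum_congr rfl fun a _ => ?_
  have hd : ∀ k, p ∣ p ^ m * k + a ↔ p ∣ a := fun k =>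
    Nat.dvd_add_right ((dvd_pow_self p (by omega)).mul_right k)
  simp only [hd]
  split_ifs with h
  · simp
  have he : ∀ k : ℕ, cexp (2 * Real.pi * I * (((p ^ m * k + a : ℕ) : ℂ) * c) / p ^ (i + 1)) =
      cexp (2 * Real.pi * I * (a * c) / p ^ (i + 1)) := by
    intro k
    have := exp_period ((p ^ m * k + a) * c) (a * c) (p ^ (i + 1)) (by positivity) (by
      apply Nat.ModEq.mul_right
      have : p ^ m * k ≡ 0 [MOD p ^ (i + 1)] :=
        (Nat.modEq_zero_iff_dvd).mpr ((pow_dvd_pow p hi).mul_right k)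
      simpa using this.add_right a)
    push_cast at this ⊢
    exact this
  simp only [he]
  rw [← Finset.sum_mul]
  congr 1
  have hg : (∑ k ∈ Finset.range p, (k : ℂ)) * 2 = p * (p - 1) := by
    have := Finset.sum_range_id_mul_two p
    have h2 : ((∑ k ∈ Finset.range p, k : ℕ) : ℂ) * 2 = p * ((p - 1 : ℕ) : ℂ) := by
      exact_mod_cast this
    rw [Nat.cast_sub (Nat.one_le_iff_ne_zero.mpr hp)] at h2
    simpa using h2
  have hs : ∀ k : ℕ, (((p ^ m * k + a : ℕ) : ℂ) / p ^ (m + 1) - 1 / 2) =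
      (k : ℂ) * (1 / p) + (a / p ^ (m + 1) - 1 / 2) := by
    intro k
    push_cast
    field_simp
    ring
  simp only [hs]
  rw [Finset.sum_add_distrib, ← Finset.sum_mul, Finset.sum_const, Finset.card_range, nsmul_eq_mul]
  have hg' : (∑ k ∈ Finset.range p, (k : ℂ)) = p * (p - 1) / 2 := by linear_combination hg / 2
  rw [hg']
  field_simp
  ring

lemma SS_succ (p m c : ℕ) (hp : p ≠ 0) : SS p (m + 1) c = UU p (m + 1) m c + SS p m c := by
  have hp' : (p : ℂ) ≠ 0 := by exact_mod_cast hp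
  have key : SS p m c = ∑ a ∈ Finset.range (p ^ (m + 1)), if p ∣ a then (if a = 0 then 0 else
      ((a : ℂ) / p ^ (m + 1) - 1 / 2) * cexp (2 * Real.pi * I * (a * c) / p ^ (m + 1))) else 0 := by
    rw [pow_succ', sum_range_mul', SS]
    refine Finset.sum_congr rfl fun k _ => ?_
    rw [Finset.sum_eq_single 0]
    · by_cases hk : k = 0
      · simp [hk]
      · simp only [add_zero, dvd_mul_right, if_true, mul_eq_zero, hp, hk, or_self, if_false]
        push_cast
        congr 2
        · rw [pow_succ']; field_simp
        · rw [pow_succ']; field_simp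
    · intro a ha ha0
      rw [if_neg]
      rw [Nat.dvd_add_right (dvd_mul_right p k)]
      exact Nat.not_dvd_of_pos_of_lt (Nat.pos_of_ne_zero ha0) (Finset.mem_range.mp ha)
    · intro h
      simp at h
      exact absurd h hp
  rw [key, UU, SS, ← Finset.sum_add_distrib]
  refine Finset.sum_congr rfl fun a _ => ?_
  by_cases h : p ∣ a
  · simp [h]
  · have : a ≠ 0 := by rintro rfl; simp at h
    simp [h, this]

lemma SS_eq (p m c : ℕ) (hp : p ≠ 0) : SS p m c = ∑ i ∈ Finset.range m, UU p m i c := by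
  induction m with
  | zero => simp [SS]
  | succ m ih =>
    rw [SS_succ _ _ _ hp, ih, Finset.sum_range_succ, add_comm]
    congr 1
    refine Finset.sum_congr rfl fun i hi => ?_
    rw [UU_succ _ _ _ _ hp (by simpa [Nat.succ_le_iff] using hi)]

lemma sum_zmod (N : ℕ) [NeZero N] (f : ZMod N → ℂ) :
    ∑ j : ZMod N, f j = ∑ a ∈ Finset.range N, f (a : ZMod N) := by
  symm
  refine Finset.sum_nbij' (fun a => (a : ZMod N)) (fun j => j.val) ?_ ?_ ?_ ?_ ?_
  · simp
  · intro j _; simpa using ZMod.val_lt j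
  · intro a ha; exact ZMod.val_cast_of_lt (by simpa using ha)
  · intro j _; simp
  · simp

lemma sum_units (N : ℕ) [NeZero N] (f : ZMod N → ℂ) :
    ∑ u : (ZMod N)ˣ, f u = ∑ j : ZMod N, if IsUnit j then f j else 0 := by
  rw [← Finset.sum_filter]
  refine Finset.sum_bij (fun u _ => (u : ZMod N)) ?_ ?_ ?_ ?_
  · intro u _; simp
  · intro u _ v _ h; exact Units.ext h
  · intro j hj
    obtain ⟨u, rfl⟩ := (Finset.mem_filter.mp hj).2
    exact ⟨u, Finset.mem_univ _, rfl⟩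
  · simp

lemma key_identity (p n : ℕ) [hp : Fact p.Prime] (b : ZMod (p ^ (n + 1))) :
    ∑ a : (ZMod (p ^ (n + 1)))ˣ, (((a : ZMod (p ^ (n + 1))).val : ℂ) / ((p ^ (n + 1) : ℕ) : ℂ) - 1 / 2) *
      ∑ i ∈ Finset.range (n + 1), cexp (2 * (Real.pi : ℂ) * I *
        (((a * b : ZMod (p ^ (n + 1))).val : ℂ)) / (p ^ (i + 1) : ℂ)) = sawF (p ^ (n + 1)) b := by
  have hp0 : p ≠ 0 := hp.out.ne_zero
  have h1 : sawF (p ^ (n + 1)) b = SS p (n + 1) b.val := by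
    rw [sawF, sum_zmod, SS]
    refine Finset.sum_congr rfl fun a ha => ?_
    have hval : (a : ZMod (p ^ (n + 1))).val = a := ZMod.val_cast_of_lt (by simpa using ha)
    have h0 : (a : ZMod (p ^ (n + 1))) = 0 ↔ a = 0 := by
      rw [← ZMod.val_eq_zero, hval]
    simp only [saw, h0, hval, ite_mul, zero_mul]
    split_ifs with h
    · rfl
    · push_cast
      congr 1
      have : b * (a : ZMod (p ^ (n + 1))) = ((a * b.val : ℕ) : ℤ) := by
        push_cast; simp [mul_comm]
      rw [this, ZMod.stdAddChar_coe]
      push_cast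
      rfl
  rw [h1, SS_eq _ _ _ hp0]
  simp only [Finset.mul_sum]
  rw [Finset.sum_comm]
  refine Finset.sum_congr rfl fun i hi => ?_
  rw [sum_units _ (fun a => ((a.val : ℂ) / ((p ^ (n + 1) : ℕ) : ℂ) - 1 / 2) *
    cexp (2 * (Real.pi : ℂ) * I * (((a * b : ZMod (p ^ (n + 1))).val : ℂ)) / (p ^ (i + 1) : ℂ))),
    sum_zmod, UU]
  refine Finset.sum_congr rfl fun a ha => ?_
  have hval : (a : ZMod (p ^ (n + 1))).val = a := ZMod.val_cast_of_lt (by simpa using ha)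
  have hu : IsUnit (a : ZMod (p ^ (n + 1))) ↔ ¬ p ∣ a := by
    rw [ZMod.isUnit_iff_coprime, Nat.coprime_pow_right_iff (by omega), Nat.coprime_comm,
      hp.out.coprime_iff_not_dvd]
  simp only [hu, hval, ite_not]
  split_ifs with h
  · rfl
  · have := exp_period ((a * b : ZMod (p ^ (n + 1))).val) (a * b.val) (p ^ (i + 1)) (by positivity) (by
      rw [ZMod.val_mul, hval]
      exact (Nat.mod_modEq _ _).of_dvd (pow_dvd_pow p (by simpa [Nat.lt_succ_iff] using hi)))
    push_cast at this ⊢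
    rw [this]

lemma coeff_identity (N : ℕ) [NeZero N] (b : (ZMod N)ˣ) :
    I / ((Real.pi : ℂ) * (Nat.totient N : ℂ)) * ∑ χ : DirichletCharacter ℂ N,
      (if χ.Odd then DirichletCharacter.LFunction χ 1 * χ⁻¹ (b : ZMod N) else 0)
    = -(1 / (N : ℂ)) * sawF N b := by
  have hφ : (Nat.totient N : ℂ) ≠ 0 := by
    exact_mod_cast (Nat.totient_pos.mpr (NeZero.pos N)).ne'
  have hpi : (Real.pi : ℂ) ≠ 0 := by exact_mod_cast Real.pi_ne_zero
  have h1 : ∀ χ : DirichletCharacter ℂ N, I / (Real.pi : ℂ) *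
      (if χ.Odd then DirichletCharacter.LFunction χ 1 * χ⁻¹ (b : ZMod N) else 0) =
      -(1 / (N : ℂ)) * ∑ c : ZMod N, (χ (b : ZMod N)⁻¹ * χ c) * sawF N c := by
    intro χ
    have hinv : χ⁻¹ (b : ZMod N) = χ (b : ZMod N)⁻¹ := by
      rw [MulChar.inv_apply, Ring.inverse_unit, ZMod.inv_coe_unit]
    simp only [mul_assoc]
    rw [← Finset.mul_sum, hinv]
    split_ifs with h
    · have := LFunction_one_odd N χ h
      linear_combination χ (b : ZMod N)⁻¹ * this
    · have he : χ (-1) = 1 := (χ.even_or_odd).resolve_right h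
      have hz : ∑ c : ZMod N, χ c * sawF N c = - ∑ c : ZMod N, χ c * sawF N c := by
        conv_lhs => rw [← Equiv.sum_comp (Equiv.neg (ZMod N))]
        rw [← Finset.sum_neg_distrib]
        refine Finset.sum_congr rfl fun c _ => ?_
        rw [Equiv.neg_apply, sawF_neg, ← neg_one_mul c, map_mul, he]
        ring
      rw [self_eq_neg.mp hz]
      simp
  have h2 : I / (Real.pi : ℂ) * ∑ χ : DirichletCharacter ℂ N,
      (if χ.Odd then DirichletCharacter.LFunction χ 1 * χ⁻¹ (b : ZMod N) else 0) =
      -(1 / (N : ℂ)) * ((Nat.totient N : ℂ) * sawF N b) := by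
    rw [Finset.mul_sum, Finset.sum_congr rfl fun χ _ => h1 χ, ← Finset.mul_sum, Finset.sum_comm]
    congr 1
    simp only [← Finset.sum_mul, DirichletCharacter.sum_char_inv_mul_char_eq ℂ b.isUnit]
    simp
  rw [← div_div, div_mul_eq_mul_div, h2]
  field_simp

end EquivL

/-- For an odd prime `p` and `n ≥ 0`, in `ℂ[(ℤ/p^{n+1}ℤ)ˣ]` one has
`(i/(π·φ(p^{n+1}))) · ∑_{χ odd} L(1,χ) · ∑_b χ⁻¹(b)·[b]
  = θ_{p^{n+1}} · ∑_a ((1/p^{n+1}) · ∑_{i=0}^{n} exp(2πi·ã/p^{i+1})) · [a]`. -/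
theorem equivariant_L_value_prime_power (p : ℕ) [Fact p.Prime] (hp2 : Odd p) (n : ℕ) :
    (Complex.I / ((Real.pi : ℂ) * (Nat.totient (p ^ (n + 1)) : ℂ))) •
      ∑ χ : DirichletCharacter ℂ (p ^ (n + 1)),
        (if χ.Odd then
          (DirichletCharacter.LFunction χ 1) •
            ∑ b : (ZMod (p ^ (n + 1)))ˣ, MonoidAlgebra.single b (χ⁻¹ ((b : ZMod (p ^ (n + 1)))))
        else 0)
    = stickelbergerElt (p ^ (n + 1)) *
        ∑ a : (ZMod (p ^ (n + 1)))ˣ,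
          MonoidAlgebra.single a
            ((1 / (p ^ (n + 1) : ℂ)) *
              ∑ i ∈ Finset.range (n + 1),
                Complex.exp (2 * (Real.pi : ℂ) * Complex.I *
                  (((a : ZMod (p ^ (n + 1))).val : ℂ)) / (p ^ (i + 1) : ℂ))) := by
  have hsum : ∀ (b : (ZMod (p ^ (n + 1)))ˣ) {ι : Type} (s : Finset ι) (f : ι → ℂ),
      ∑ i ∈ s, MonoidAlgebra.single b (f i) = MonoidAlgebra.single b (∑ i ∈ s, f i) :=
    fun b ι s f => (map_sum (MonoidAlgebra.singleAddHom b) f s).symm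
  have hL : ∀ χ : DirichletCharacter ℂ (p ^ (n + 1)),
      (if χ.Odd then (DirichletCharacter.LFunction χ 1) •
        ∑ b : (ZMod (p ^ (n + 1)))ˣ, MonoidAlgebra.single b (χ⁻¹ ((b : ZMod (p ^ (n + 1)))))
        else 0) = ∑ b : (ZMod (p ^ (n + 1)))ˣ, MonoidAlgebra.single b
          (if χ.Odd then DirichletCharacter.LFunction χ 1 * χ⁻¹ (b : ZMod (p ^ (n + 1))) else 0) := by
    intro χ
    split_ifs
    · simp [Finset.smul_sum]
    · simp
  rw [Finset.sum_congr rfl fun χ _ => hL χ, Finset.sum_comm, Finset.smul_sum, stickelbergerElt,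
    neg_mul, Finset.sum_mul_sum]
  simp only [MonoidAlgebra.single_mul_single]
  have hR : ∀ a : (ZMod (p ^ (n + 1)))ˣ, ∀ F : (ZMod (p ^ (n + 1)))ˣ → ℂ,
      ∑ d : (ZMod (p ^ (n + 1)))ˣ, MonoidAlgebra.single (a⁻¹ * d) (F d) =
      ∑ b : (ZMod (p ^ (n + 1)))ˣ, MonoidAlgebra.single b (F (a * b)) := by
    intro a F
    rw [← Equiv.sum_comp (Equiv.mulLeft a)]
    simp
  simp only [hR]
  rw [Finset.sum_comm, ← Finset.sum_neg_distrib]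
  refine Finset.sum_congr rfl fun b _ => ?_
  rw [hsum, hsum, MonoidAlgebra.smul_single, smul_eq_mul, EquivL.coeff_identity,
    ← MonoidAlgebra.single_neg]
  congr 1
  rw [← EquivL.key_identity p n (b : ZMod (p ^ (n + 1))), neg_mul, Finset.mul_sum]
  congr 1
  refine Finset.sum_congr rfl fun a _ => ?_
  push_cast
  ring
end

section
/- Let p be an odd prime and let i ≥ j ≥ 0 be integers. The ℚ-algebra homomorphism ℚ[(ℤ/p^{i+1}ℤ)ˣ] → ℚ[(ℤ/p^{j+1}ℤ)ˣ] induced by the reduction map (ℤ/p^{i+1}ℤ)ˣ → (ℤ/p^{j+1}ℤ)ˣ sends the Stickelberger element θ_{p^{i+1}} to the Stickelberger element θ_{p^{j+1}}. -/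
/-- The Stickelberger element `θ_r = -∑_{a ∈ (ℤ/rℤ)ˣ} (ã/r - 1/2)·[a]⁻¹` in the rational
group algebra of `(ℤ/rℤ)ˣ`. -/
noncomputable def stickelbergerEltQ (r : ℕ) [NeZero r] : MonoidAlgebra ℚ (ZMod r)ˣ :=
  -∑ a : (ZMod r)ˣ, MonoidAlgebra.single a⁻¹ ((((a : ZMod r).val : ℚ) / r - 1 / 2))

/-- Sum of the coefficients over a fibre of the reduction map. -/
theorem stick_fibre_sum (q k n : ℕ) [NeZero q] [NeZero n] (hn : n = q * k) (hq : q ∣ n)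
    (hc : ∀ x : ℕ, Nat.Coprime x q → Nat.Coprime x n) (b : (ZMod q)ˣ) :
    ∑ a : (ZMod n)ˣ with ZMod.unitsMap hq a = b, (((a : ZMod n).val : ℚ) / n - 1 / 2)
      = ((b : ZMod q).val : ℚ) / q - 1 / 2 := by
  have hq0 : 0 < q := Nat.pos_of_ne_zero (NeZero.ne q)
  have hn0 : n ≠ 0 := NeZero.ne n
  have hk0 : k ≠ 0 := by
    rintro rfl
    simp at hn
    exact hn0 hn
  have key : ∀ a : (ZMod n)ˣ, ((ZMod.unitsMap hq a : (ZMod q)ˣ) : ZMod q).val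
      = (a : ZMod n).val % q := by
    intro a
    rw [ZMod.unitsMap_val, ZMod.cast_eq_val, ZMod.val_natCast]
  have hbij : ∑ a : (ZMod n)ˣ with ZMod.unitsMap hq a = b, (((a : ZMod n).val : ℚ) / n - 1 / 2)
      = ∑ m ∈ Finset.range k, ((((b : ZMod q).val + q * m : ℕ) : ℚ) / n - 1 / 2) := by
    have hb : ∀ a : (ZMod n)ˣ, ZMod.unitsMap hq a = b →
        (a : ZMod n).val % q = (b : ZMod q).val := by
      rintro a rfl
      exact (key a).symm
    refine Finset.sum_bij (fun a _ => (a : ZMod n).val / q) ?_ ?_ ?_ ?_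
    · intro a _
      rw [Finset.mem_range]
      apply Nat.div_lt_of_lt_mul
      rw [← hn]
      exact ZMod.val_lt _
    · intro a ha a' ha' h
      have h1 := hb a (Finset.mem_filter.mp ha).2
      have h2 := hb a' (Finset.mem_filter.mp ha').2
      apply Units.ext
      apply ZMod.val_injective n
      rw [← Nat.mod_add_div (a : ZMod n).val q, ← Nat.mod_add_div (a' : ZMod n).val q, h1, h2]
      rw [h]
    · intro m hm
      rw [Finset.mem_range] at hm
      have hblt := ZMod.val_lt (b : ZMod q)
      have hcop : Nat.Coprime ((b : ZMod q).val + q * m) n := by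
        apply hc
        have := ZMod.val_coe_unit_coprime b
        simpa using this
      have hlt : (b : ZMod q).val + q * m < n := by
        rw [hn]
        calc (b : ZMod q).val + q * m < q + q * m := by omega
          _ = q * (m + 1) := by ring
          _ ≤ q * k := Nat.mul_le_mul_left _ hm
      have hval : ((ZMod.unitOfCoprime _ hcop : (ZMod n)ˣ) : ZMod n).val
          = (b : ZMod q).val + q * m := by
        rw [ZMod.coe_unitOfCoprime, ZMod.val_natCast, Nat.mod_eq_of_lt hlt]
      refine ⟨ZMod.unitOfCoprime _ hcop, ?_, ?_⟩
      · rw [Finset.mem_filter]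
        refine ⟨Finset.mem_univ _, ?_⟩
        apply Units.ext
        apply ZMod.val_injective q
        rw [key, hval, Nat.add_mul_mod_self_left, Nat.mod_eq_of_lt hblt]
      · rw [hval, Nat.add_mul_div_left _ _ hq0, Nat.div_eq_of_lt hblt, zero_add]
    · intro a ha
      rw [← hb a (Finset.mem_filter.mp ha).2, Nat.mod_add_div]
  rw [hbij]
  have hsum : ∀ (c d : ℚ) (l : ℕ), ∑ m ∈ Finset.range l, (c + d * m)
      = l * c + d * (l * (l - 1) / 2) := by
    intro c d l
    induction l with
    | zero => simp
    | succ l ih => rw [Finset.sum_range_succ, ih]; push_cast; ring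
  have hqQ : (q : ℚ) ≠ 0 := by exact_mod_cast hq0.ne'
  have hkQ : (k : ℚ) ≠ 0 := by exact_mod_cast hk0
  have : ∀ m ∈ Finset.range k, ((((b : ZMod q).val + q * m : ℕ) : ℚ) / n - 1 / 2)
      = (((b : ZMod q).val : ℚ) / (q * k) - 1 / 2) + (1 / k : ℚ) * m := by
    intro m _
    rw [hn]
    push_cast
    field_simp
    ring
  rw [Finset.sum_congr rfl this, hsum]
  field_simp
  ring

/-- For an odd prime `p` and integers `i ≥ j ≥ 0`, the ℚ-algebra homomorphism
`ℚ[(ℤ/p^{i+1}ℤ)ˣ] → ℚ[(ℤ/p^{j+1}ℤ)ˣ]` induced by the reduction map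
`(ℤ/p^{i+1}ℤ)ˣ → (ℤ/p^{j+1}ℤ)ˣ` sends `θ_{p^{i+1}}` to `θ_{p^{j+1}}`. -/
theorem stickelberger_compatible (p : ℕ) [Fact p.Prime] (hodd : Odd p)
    (i j : ℕ) (hij : j ≤ i) :
    MonoidAlgebra.mapDomainRingHom ℚ
        (ZMod.unitsMap (pow_dvd_pow p (Nat.succ_le_succ hij)))
        (stickelbergerEltQ (p ^ (i + 1)))
      = stickelbergerEltQ (p ^ (j + 1)) := by
  have hn : p ^ (i + 1) = p ^ (j + 1) * p ^ (i - j) := by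
    rw [← pow_add]
    congr 1
    omega
  have hc : ∀ x : ℕ, Nat.Coprime x (p ^ (j + 1)) → Nat.Coprime x (p ^ (i + 1)) := by
    intro x hx
    exact Nat.Coprime.pow_right _ ((Nat.coprime_pow_right_iff (Nat.succ_pos j) _ _).mp hx)
  unfold stickelbergerEltQ
  rw [map_neg, map_sum]
  congr 1
  rw [← Finset.sum_fiberwise Finset.univ
    (ZMod.unitsMap (pow_dvd_pow p (Nat.succ_le_succ hij)))]
  refine Finset.sum_congr rfl fun b _ => ?_
  rw [← stick_fibre_sum (p ^ (j + 1)) (p ^ (i - j)) (p ^ (i + 1)) hn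
    (pow_dvd_pow p (Nat.succ_le_succ hij)) hc b]
  rw [← MonoidAlgebra.singleAddHom_apply, map_sum]
  refine Finset.sum_congr rfl fun a ha => ?_
  rw [MonoidAlgebra.singleAddHom_apply, ← (Finset.mem_filter.mp ha).2, ← map_inv]
  rw [MonoidAlgebra.mapDomainRingHom_apply, MonoidAlgebra.mapDomain_single]
end

section
/- Let p be an odd prime, n ≥ 0 an integer, G = (ℤ/p^{n+1}ℤ)ˣ, and let θ_n ∈ ℚ_p[G] be the Stickelberger element. Then the set { y ∈ ℤ_p[G] : θ_n·y ∈ ℤ_p[G] } is equal to the ideal of ℤ_p[G] generated by the elements [a] − a, where a runs over all integers coprime to 2p, [a] denotes the class of a in G viewed in ℤ_p[G], and the second a denotes the image of a in ℤ_p viewed as a scalar in ℤ_p[G]. -/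
/-- The Stickelberger element `θ_n = -∑_{a ∈ G} (ã/p^{n+1} - 1/2)·[a]⁻¹` in the group algebra
`ℚ_p[G]`, where `G = (ℤ/p^{n+1}ℤ)ˣ`. -/
noncomputable def padicStickelberger (p : ℕ) [Fact p.Prime] (n : ℕ) :
    MonoidAlgebra ℚ_[p] (ZMod (p ^ (n + 1)))ˣ :=
  -∑ a : (ZMod (p ^ (n + 1)))ˣ,
    MonoidAlgebra.single a⁻¹
      ((((a : ZMod (p ^ (n + 1))).val : ℚ_[p]) / (p ^ (n + 1) : ℚ_[p]) - 1 / 2))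

/-- The natural inclusion `ℤ_p[G] → ℚ_p[G]` of group rings (coefficientwise `ℤ_p ↪ ℚ_p`),
realising `ℤ_p[G]` as a subring of `ℚ_p[G]`. -/
noncomputable def groupRingIncl (p : ℕ) [Fact p.Prime] (n : ℕ) :
    MonoidAlgebra ℤ_[p] (ZMod (p ^ (n + 1)))ˣ →+* MonoidAlgebra ℚ_[p] (ZMod (p ^ (n + 1)))ˣ :=
  MonoidAlgebra.liftNCRingHom
    (MonoidAlgebra.singleOneRingHom.comp (PadicInt.Coe.ringHom (p := p)))
    (MonoidAlgebra.of ℚ_[p] (ZMod (p ^ (n + 1)))ˣ)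
    (fun _ _ => Commute.all _ _)

open MonoidAlgebra in
lemma groupRingIncl_single (p : ℕ) [Fact p.Prime] (n : ℕ) (g : (ZMod (p ^ (n + 1)))ˣ) (r : ℤ_[p]) :
    groupRingIncl p n (single g r) = single g (r : ℚ_[p]) := by
  simp only [groupRingIncl, liftNCRingHom_single]
  simp [single_mul_single]
  rfl

open MonoidAlgebra in
lemma groupRingIncl_coeff (p : ℕ) [Fact p.Prime] (n : ℕ) (g : (ZMod (p ^ (n + 1)))ˣ)
    (x : MonoidAlgebra ℤ_[p] (ZMod (p ^ (n + 1)))ˣ) :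
    (groupRingIncl p n x).coeff g = (x.coeff g : ℚ_[p]) := by
  classical
  induction x using induction_linear with
  | zero => simp
  | add x y hx hy => simp [hx, hy]
  | single a r =>
    rw [groupRingIncl_single, coeff_single, coeff_single, Finsupp.single_apply, Finsupp.single_apply]
    split_ifs <;> simp

/-- Reduction map `[b] ↦ b`. -/
noncomputable def stickRed (p : ℕ) [Fact p.Prime] (n : ℕ) :
    MonoidAlgebra ℤ_[p] (ZMod (p ^ (n + 1)))ˣ →+* ZMod (p ^ (n + 1)) :=
  MonoidAlgebra.liftNCRingHom (PadicInt.toZModPow (n + 1))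
    (Units.coeHom (ZMod (p ^ (n + 1)))) (fun _ _ => Commute.all _ _)

lemma stickRed_single (p : ℕ) [Fact p.Prime] (n : ℕ) (g : (ZMod (p ^ (n + 1)))ˣ) (r : ℤ_[p]) :
    stickRed p n (MonoidAlgebra.single g r) = PadicInt.toZModPow (n + 1) r * g := by
  simp only [stickRed, MonoidAlgebra.liftNCRingHom_single]
  rfl

/-- The integral multiple `2 p^(n+1) θ`. -/
noncomputable def stickInt (p : ℕ) [Fact p.Prime] (n : ℕ) :
    MonoidAlgebra ℤ_[p] (ZMod (p ^ (n + 1)))ˣ :=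
  ∑ a : (ZMod (p ^ (n + 1)))ˣ,
    MonoidAlgebra.single a⁻¹ ((p : ℤ_[p]) ^ (n + 1) - 2 * ((a : ZMod (p ^ (n + 1))).val : ℤ_[p]))

lemma stickInt_coeff (p : ℕ) [Fact p.Prime] (n : ℕ) (g : (ZMod (p ^ (n + 1)))ˣ) :
    (stickInt p n).coeff g =
      (p : ℤ_[p]) ^ (n + 1) - 2 * (((g⁻¹ : (ZMod (p ^ (n + 1)))ˣ) : ZMod (p ^ (n + 1))).val : ℤ_[p]) := by
  classical
  simp only [stickInt, MonoidAlgebra.coeff_sum, Finsupp.finsetSum_apply,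
    MonoidAlgebra.coeff_single, Finsupp.single_apply]
  rw [Finset.sum_eq_single g⁻¹]
  · simp
  · intro b _ hb
    rw [if_neg]
    rintro rfl
    simp at hb
  · simp

lemma padicInt_coe_two (p : ℕ) [Fact p.Prime] : ((2 : ℤ_[p]) : ℚ_[p]) = 2 :=
  map_ofNat (PadicInt.Coe.ringHom (p := p)) 2

lemma groupRingIncl_stickInt (p : ℕ) [Fact p.Prime] (n : ℕ) :
    groupRingIncl p n (stickInt p n) = (2 * p ^ (n + 1) : ℕ) • padicStickelberger p n := by
  have hp : (p : ℚ_[p]) ≠ 0 := by exact_mod_cast (Fact.out : p.Prime).ne_zero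
  rw [stickInt, padicStickelberger, map_sum, ← Finset.sum_neg_distrib, Finset.smul_sum]
  refine Finset.sum_congr rfl fun a _ => ?_
  rw [groupRingIncl_single, ← MonoidAlgebra.single_neg, MonoidAlgebra.smul_single]
  congr 1
  rw [nsmul_eq_mul]
  push_cast
  rw [padicInt_coe_two]
  field_simp
  ring

lemma stickInt_mul_coeff (p : ℕ) [Fact p.Prime] (n : ℕ) (g : (ZMod (p ^ (n + 1)))ˣ)
    (y : MonoidAlgebra ℤ_[p] (ZMod (p ^ (n + 1)))ˣ) :
    PadicInt.toZModPow (n + 1) ((stickInt p n * y).coeff g) =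
      -2 * (stickRed p n y * ((g⁻¹ : (ZMod (p ^ (n + 1)))ˣ) : ZMod (p ^ (n + 1)))) := by
  have hN : ((p : ZMod (p ^ (n + 1))) ^ (n + 1)) = 0 := by
    rw [← Nat.cast_pow, ZMod.natCast_self]
  have : NeZero (p ^ (n + 1)) := ⟨pow_ne_zero _ (Fact.out : p.Prime).ne_zero⟩
  induction y using MonoidAlgebra.induction_linear with
  | zero => simp
  | add x y hx hy =>
    rw [mul_add, MonoidAlgebra.coeff_add, Finsupp.add_apply, map_add, hx, hy, map_add]
    ring
  | single a r =>
    rw [MonoidAlgebra.coeff_mul_single_apply, stickInt_coeff, stickRed_single]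
    simp only [map_mul, map_sub, map_pow, map_natCast, map_ofNat, hN, ZMod.natCast_zmod_val,
      mul_inv_rev, inv_inv, Units.val_mul]
    ring

lemma exists_two_mul (p : ℕ) [Fact p.Prime] (hodd : Odd p) : ∃ w : ℤ_[p], 2 * w = 1 := by
  have : IsUnit (2 : ℤ_[p]) := by
    have h := (PadicInt.norm_natCast_eq_one_iff (p := p) (n := 2)).2
      (Nat.coprime_two_right.2 hodd)
    rw [← PadicInt.isUnit_iff] at h
    exact_mod_cast h
  exact this.exists_right_inv

lemma stick_iff_red (p : ℕ) [Fact p.Prime] (hodd : Odd p) (n : ℕ)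
    (y : MonoidAlgebra ℤ_[p] (ZMod (p ^ (n + 1)))ˣ) :
    (∃ z : MonoidAlgebra ℤ_[p] (ZMod (p ^ (n + 1)))ˣ,
        groupRingIncl p n z = padicStickelberger p n * groupRingIncl p n y)
      ↔ stickRed p n y = 0 := by
  have hp : p ≠ 0 := (Fact.out : p.Prime).ne_zero
  obtain ⟨w, hw⟩ := exists_two_mul p hodd
  have hN : ((p : ZMod (p ^ (n + 1))) ^ (n + 1)) = 0 := by
    rw [← Nat.cast_pow, ZMod.natCast_self]
  have key : groupRingIncl p n (stickInt p n * y) =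
      (2 * p ^ (n + 1) : ℕ) • (padicStickelberger p n * groupRingIncl p n y) := by
    rw [map_mul, groupRingIncl_stickInt, smul_mul_assoc]
  constructor
  · rintro ⟨z, hz⟩
    rw [← hz] at key
    have h1 := congrArg (fun x => x.coeff 1) key
    simp only [MonoidAlgebra.coeff_smul_apply, groupRingIncl_coeff] at h1
    rw [nsmul_eq_mul] at h1
    have h2 : (stickInt p n * y).coeff 1 = (p : ℤ_[p]) ^ (n + 1) * (2 * z.coeff 1) := by
      apply Subtype.ext
      push_cast at h1 ⊢
      rw [padicInt_coe_two]
      linear_combination h1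
    have h3 := stickInt_mul_coeff p n 1 y
    rw [h2] at h3
    simp only [map_mul, map_natCast, map_pow, hN] at h3
    have h4 := congrArg (PadicInt.toZModPow (n + 1)) hw
    simp only [map_mul, map_ofNat, map_one] at h4
    simp only [zero_mul, inv_one, Units.val_one, mul_one] at h3
    calc stickRed p n y = (2 * PadicInt.toZModPow (n + 1) w) * stickRed p n y := by rw [h4, one_mul]
      _ = PadicInt.toZModPow (n + 1) w * (2 * stickRed p n y) := by ring
      _ = 0 := by linear_combination (PadicInt.toZModPow (n + 1) w) * h3
  · intro hy
    have hc : ∀ g, ∃ c, (stickInt p n * y).coeff g = (p : ℤ_[p]) ^ (n + 1) * c := by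
      intro g
      have h := stickInt_mul_coeff p n g y
      rw [hy, zero_mul, mul_zero, ← RingHom.mem_ker, PadicInt.ker_toZModPow,
        Ideal.mem_span_singleton] at h
      exact h
    choose c hc using hc
    refine ⟨MonoidAlgebra.ofCoeff (Finsupp.equivFunOnFinite.symm fun g => w * c g), ?_⟩
    ext g
    have h1 := congrArg (fun x => x.coeff g) key
    simp only [MonoidAlgebra.coeff_smul_apply, groupRingIncl_coeff, hc] at h1
    rw [nsmul_eq_mul] at h1
    rw [groupRingIncl_coeff]
    have h0 : (((2 * p ^ (n + 1) : ℕ)) : ℚ_[p]) ≠ 0 := by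
      exact_mod_cast (by positivity : 2 * p ^ (n + 1) ≠ 0)
    apply mul_left_cancel₀ h0
    rw [← h1]
    have hw' : (2 : ℚ_[p]) * (w : ℚ_[p]) = 1 := by
      have := congrArg (fun x : ℤ_[p] => (x : ℚ_[p])) hw
      simpa [padicInt_coe_two] using this
    simp
    linear_combination ((p : ℚ_[p]) ^ (n + 1) * (c g : ℚ_[p])) * hw'

lemma red_iff_span (p : ℕ) [Fact p.Prime] (hodd : Odd p) (n : ℕ)
    (y : MonoidAlgebra ℤ_[p] (ZMod (p ^ (n + 1)))ˣ) :
    stickRed p n y = 0 ↔ y ∈ Ideal.span {x : MonoidAlgebra ℤ_[p] (ZMod (p ^ (n + 1)))ˣ |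
          ∃ (a : ℤ) (u : (ZMod (p ^ (n + 1)))ˣ),
            IsCoprime a (2 * (p : ℤ)) ∧ ((u : ZMod (p ^ (n + 1))) = (a : ZMod (p ^ (n + 1)))) ∧
              x = MonoidAlgebra.single u 1 - (a : MonoidAlgebra ℤ_[p] (ZMod (p ^ (n + 1)))ˣ)} := by
  set I := Ideal.span {x : MonoidAlgebra ℤ_[p] (ZMod (p ^ (n + 1)))ˣ |
          ∃ (a : ℤ) (u : (ZMod (p ^ (n + 1)))ˣ),
            IsCoprime a (2 * (p : ℤ)) ∧ ((u : ZMod (p ^ (n + 1))) = (a : ZMod (p ^ (n + 1)))) ∧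
              x = MonoidAlgebra.single u 1 - (a : MonoidAlgebra ℤ_[p] (ZMod (p ^ (n + 1)))ˣ)} with hI
  have hp : p ≠ 0 := (Fact.out : p.Prime).ne_zero
  have : NeZero (p ^ (n + 1)) := ⟨pow_ne_zero _ hp⟩
  obtain ⟨w, hw⟩ := exists_two_mul p hodd
  have hN : ((p : ZMod (p ^ (n + 1))) ^ (n + 1)) = 0 := by
    rw [← Nat.cast_pow, ZMod.natCast_self]
  have hle : I ≤ RingHom.ker (stickRed p n) := by
    rw [hI, Ideal.span_le]
    rintro x ⟨a, u, -, hu, rfl⟩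
    simp [RingHom.mem_ker, stickRed_single, hu]
  refine ⟨fun hy => ?_, fun hy => hle hy⟩
  -- the element p^(n+1) lies in I
  have hNI : (MonoidAlgebra.single 1 ((p : ℤ_[p]) ^ (n + 1)) :
      MonoidAlgebra ℤ_[p] (ZMod (p ^ (n + 1)))ˣ) ∈ I := by
    have hgen : (MonoidAlgebra.single 1 1 - ((1 + 2 * (p : ℤ) ^ (n + 1) : ℤ) :
        MonoidAlgebra ℤ_[p] (ZMod (p ^ (n + 1)))ˣ)) ∈ I := by
      refine Ideal.subset_span ⟨_, 1, ⟨1, -((p : ℤ) ^ n), by ring⟩, ?_, rfl⟩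
      push_cast
      simp [hN]
    have := I.mul_mem_left (MonoidAlgebra.single 1 (-w)) hgen
    convert this using 1
    rw [MonoidAlgebra.intCast_def, ← MonoidAlgebra.single_sub, MonoidAlgebra.single_mul_single]
    congr 1
    · simp
    · push_cast
      linear_combination (-(p : ℤ_[p]) ^ (n + 1)) * hw
  -- every element is congruent to a scalar mod I
  have hsc : ∀ x : MonoidAlgebra ℤ_[p] (ZMod (p ^ (n + 1)))ˣ,
      ∃ r : ℤ_[p], x - MonoidAlgebra.single 1 r ∈ I := by
    intro x
    induction x using MonoidAlgebra.induction_linear with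
    | zero => exact ⟨0, by simp⟩
    | add x y hx hy =>
      obtain ⟨r, hr⟩ := hx
      obtain ⟨s, hs⟩ := hy
      refine ⟨r + s, ?_⟩
      rw [MonoidAlgebra.single_add, add_sub_add_comm]
      exact I.add_mem hr hs
    | single u r =>
      have hco : IsCoprime ((u : ZMod (p ^ (n + 1))).val : ℤ) (p : ℤ) := by
        have h := ZMod.val_coe_unit_coprime u
        exact (Nat.isCoprime_iff_coprime.2 h).of_isCoprime_of_dvd_right (by
          push_cast; exact dvd_pow_self _ (Nat.succ_ne_zero n))
      obtain ⟨a, ha2, hap, hau⟩ : ∃ a : ℤ, Odd a ∧ IsCoprime a (p : ℤ) ∧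
          ((u : ZMod (p ^ (n + 1))) = (a : ZMod (p ^ (n + 1)))) := by
        rcases Nat.even_or_odd (u : ZMod (p ^ (n + 1))).val with he | ho
        · refine ⟨((u : ZMod (p ^ (n + 1))).val : ℤ) + (p : ℤ) ^ n * p, ?_, ?_, ?_⟩
          · refine Even.add_odd (by exact_mod_cast he) ?_
            exact_mod_cast (hodd.pow.mul hodd)
          · exact IsCoprime.add_mul_right_left hco _
          · push_cast
            rw [← pow_succ, hN]
            simp
        · exact ⟨_, by exact_mod_cast ho, hco, by simp⟩
      have hmem : (MonoidAlgebra.single u 1 - (a : MonoidAlgebra ℤ_[p] (ZMod (p ^ (n + 1)))ˣ)) ∈ I :=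
        Ideal.subset_span ⟨a, u, IsCoprime.mul_right (Int.isCoprime_iff_gcd_eq_one.2
          (by rw [Int.gcd_comm]; exact Int.isCoprime_iff_gcd_eq_one.1 (by
            obtain ⟨k, rfl⟩ := ha2
            exact ⟨-k, 1, by ring⟩))) hap, hau, rfl⟩
      refine ⟨r * a, ?_⟩
      convert I.mul_mem_left (MonoidAlgebra.single 1 r) hmem using 1
      rw [MonoidAlgebra.intCast_def, mul_sub, MonoidAlgebra.single_mul_single,
        MonoidAlgebra.single_mul_single]
      simp
  obtain ⟨r, hr⟩ := hsc y
  have h0 := hle hr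
  rw [RingHom.mem_ker, map_sub, hy, stickRed_single, zero_sub, neg_eq_zero, Units.val_one, mul_one,
    ← RingHom.mem_ker, PadicInt.ker_toZModPow, Ideal.mem_span_singleton] at h0
  obtain ⟨c, rfl⟩ := h0
  have h5 := I.add_mem hr (I.mul_mem_left (MonoidAlgebra.single 1 c) hNI)
  rw [MonoidAlgebra.single_mul_single, one_mul, mul_comm c, sub_add_cancel] at h5
  exact h5

/-- For an odd prime `p`, `n ≥ 0`, `G = (ℤ/p^{n+1}ℤ)ˣ` and `θ_n ∈ ℚ_p[G]` the Stickelberger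
element, the set `{ y ∈ ℤ_p[G] : θ_n·y ∈ ℤ_p[G] }` equals the ideal of `ℤ_p[G]` generated by
the elements `[a] - a`, for `a` running over integers coprime to `2p`. -/
theorem denominator_ideal_of_stickelberger (p : ℕ) [Fact p.Prime] (hodd : Odd p) (n : ℕ)
    (y : MonoidAlgebra ℤ_[p] (ZMod (p ^ (n + 1)))ˣ) :
    (∃ z : MonoidAlgebra ℤ_[p] (ZMod (p ^ (n + 1)))ˣ,
        groupRingIncl p n z = padicStickelberger p n * groupRingIncl p n y)
      ↔ y ∈ Ideal.span {x : MonoidAlgebra ℤ_[p] (ZMod (p ^ (n + 1)))ˣ |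
          ∃ (a : ℤ) (u : (ZMod (p ^ (n + 1)))ˣ),
            IsCoprime a (2 * (p : ℤ)) ∧ ((u : ZMod (p ^ (n + 1))) = (a : ZMod (p ^ (n + 1)))) ∧
              x = MonoidAlgebra.single u 1 - (a : MonoidAlgebra ℤ_[p] (ZMod (p ^ (n + 1)))ˣ)} := by
  exact (stick_iff_red p hodd n y).trans (red_iff_span p hodd n y)
end

section
/- Let p be an odd prime, n ≥ 0 an integer, and G = (ℤ/p^{n+1}ℤ)ˣ. Let u ∈ ℤ_pˣ be a topological generator of ℤ_pˣ (equivalently: for every k ≥ 1 the image of u generates the cyclic group (ℤ/p^kℤ)ˣ), and let ū denote the image of u in G. Then the ideal of ℤ_p[G] generated by the elements [a] − a, for a running over all integers coprime to 2p, is equal to the principal ideal of ℤ_p[G] generated by [ū] − u (where u is viewed as a scalar in ℤ_p[G]). -/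
lemma den_aux_mem (p : ℕ) [Fact p.Prime] (m : ℕ) {R : Type*} [CommRing R] [Algebra ℤ_[p] R]
    (K : Ideal R) (hK : algebraMap ℤ_[p] R ((p : ℤ_[p]) ^ m) ∈ K) (x y : ℤ_[p])
    (h : PadicInt.toZModPow m x = PadicInt.toZModPow m y) :
    algebraMap ℤ_[p] R x - algebraMap ℤ_[p] R y ∈ K := by
  have h1 : x - y ∈ RingHom.ker (PadicInt.toZModPow (p := p) m) := by
    rw [RingHom.mem_ker, map_sub, h, sub_self]
  rw [PadicInt.ker_toZModPow, Ideal.mem_span_singleton] at h1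
  obtain ⟨w, hw⟩ := h1
  rw [← map_sub, hw, map_mul]
  exact K.mul_mem_right _ hK

lemma den_aux_unit (p : ℕ) [Fact p.Prime] (n : ℕ) (u : ℤ_[p]ˣ)
    (hu : ∀ k : ℕ, 1 ≤ k →
      Subgroup.zpowers (Units.map (PadicInt.toZModPow (p := p) k).toMonoidHom u) = ⊤) :
    ∃ w : ℤ_[p], IsUnit w ∧
      (u : ℤ_[p]) ^ (Nat.totient (p ^ (n + 1))) - 1 = (p : ℤ_[p]) ^ (n + 1) * w := by
  have hp : p.Prime := Fact.out
  have h1 : (u : ℤ_[p]) ^ (Nat.totient (p ^ (n + 1))) - 1 ∈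
      RingHom.ker (PadicInt.toZModPow (p := p) (n + 1)) := by
    have := ZMod.pow_totient (Units.map (PadicInt.toZModPow (p := p) (n + 1)).toMonoidHom u)
    have := congrArg Units.val this
    rw [RingHom.mem_ker, map_sub, map_pow, map_one, sub_eq_zero]
    rw [Units.val_pow_eq_pow_val, Units.val_one] at this
    exact this
  rw [PadicInt.ker_toZModPow, Ideal.mem_span_singleton] at h1
  obtain ⟨w, hw⟩ := h1
  refine ⟨w, ?_, hw⟩
  by_contra hnu
  have hdvd : (p : ℤ_[p]) ∣ w := by
    rw [PadicInt.isUnit_iff] at hnu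
    rw [← PadicInt.norm_lt_one_iff_dvd]
    exact lt_of_le_of_ne (PadicInt.norm_le_one w) hnu
  obtain ⟨z, rfl⟩ := hdvd
  have h2 : (u : ℤ_[p]) ^ (Nat.totient (p ^ (n + 1))) - 1 ∈
      RingHom.ker (PadicInt.toZModPow (p := p) (n + 2)) := by
    rw [PadicInt.ker_toZModPow, Ideal.mem_span_singleton, hw]
    exact ⟨z, by ring⟩
  rw [RingHom.mem_ker, map_sub, map_pow, map_one, sub_eq_zero] at h2
  have h3 : (Units.map (PadicInt.toZModPow (p := p) (n + 2)).toMonoidHom u) ^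
      (Nat.totient (p ^ (n + 1))) = 1 := by
    ext
    simpa using h2
  have h4 := orderOf_dvd_of_pow_eq_one h3
  have : NeZero (p ^ (n + 2)) := ⟨pow_ne_zero _ hp.ne_zero⟩
  rw [orderOf_eq_card_of_zpowers_eq_top (hu (n + 2) (by omega)), Nat.card_eq_fintype_card,
    ZMod.card_units_eq_totient] at h4
  have h5 := Nat.le_of_dvd (Nat.totient_pos.2 (pow_pos hp.pos _)) h4
  rw [Nat.totient_prime_pow_succ hp, Nat.totient_prime_pow_succ hp] at h5
  have h6 := Nat.le_of_mul_le_mul_right h5 (Nat.sub_pos_of_lt hp.one_lt)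
  exact absurd h6 (not_le.2 (Nat.pow_lt_pow_right hp.one_lt (by omega)))

/-- Let `p` be an odd prime, `n ≥ 0`, `G = (ℤ/p^{n+1}ℤ)ˣ` and let `u ∈ ℤ_pˣ` be a topological
generator of `ℤ_pˣ` (i.e. for every `k ≥ 1` its image generates the cyclic group `(ℤ/p^kℤ)ˣ`).
Then the ideal of `ℤ_p[G]` generated by the elements `[a] - a` (for integers `a` coprime to
`2p`) is the principal ideal generated by `[ū] - u`, where `ū` is the image of `u` in `G`. -/
theorem denominator_ideal_principal (p : ℕ) [Fact p.Prime] (hodd : Odd p) (n : ℕ)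
    (u : ℤ_[p]ˣ)
    (hu : ∀ k : ℕ, 1 ≤ k →
      Subgroup.zpowers (Units.map (PadicInt.toZModPow (p := p) k).toMonoidHom u) = ⊤) :
    Ideal.span {x : MonoidAlgebra ℤ_[p] (ZMod (p ^ (n + 1)))ˣ |
        ∃ (a : ℤ) (v : (ZMod (p ^ (n + 1)))ˣ),
          IsCoprime a (2 * (p : ℤ)) ∧ ((v : ZMod (p ^ (n + 1))) = (a : ZMod (p ^ (n + 1)))) ∧
            x = MonoidAlgebra.single v 1 - (a : MonoidAlgebra ℤ_[p] (ZMod (p ^ (n + 1)))ˣ)}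
      = Ideal.span {MonoidAlgebra.single
            (Units.map (PadicInt.toZModPow (p := p) (n + 1)).toMonoidHom u) (1 : ℤ_[p]) -
          MonoidAlgebra.single 1 ((u : ℤ_[p]))} := by
  classical
  have hp : p.Prime := Fact.out
  have : NeZero (p ^ (n + 1)) := ⟨pow_ne_zero _ hp.ne_zero⟩
  set R := MonoidAlgebra ℤ_[p] (ZMod (p ^ (n + 1)))ˣ with hR
  set U := Units.map (PadicInt.toZModPow (p := p) (n + 1)).toMonoidHom u with hU
  have hUval : (U : ZMod (p ^ (n + 1))) = PadicInt.toZModPow (n + 1) (u : ℤ_[p]) := rfl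
  have hc : ∀ x : ℤ_[p], (MonoidAlgebra.single 1 x : R) = algebraMap ℤ_[p] R x := fun x => by
    rw [MonoidAlgebra.coe_algebraMap]; rfl
  have hci : ∀ a : ℤ, (a : R) = algebraMap ℤ_[p] R (a : ℤ_[p]) := fun a => by
    rw [map_intCast]
  apply le_antisymm
  · rw [Ideal.span_le]
    rintro x ⟨a, v, -, hv, rfl⟩
    set J := Ideal.span {(MonoidAlgebra.single U (1 : ℤ_[p]) -
          MonoidAlgebra.single 1 ((u : ℤ_[p])) : R)} with hJ
    have hpow : ∀ k : ℕ, (MonoidAlgebra.single (U ^ k) (1 : ℤ_[p]) : R) -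
        algebraMap ℤ_[p] R ((u : ℤ_[p]) ^ k) ∈ J := by
      intro k
      have h1 : (MonoidAlgebra.single (U ^ k) (1 : ℤ_[p]) : R) =
          (MonoidAlgebra.single U (1 : ℤ_[p]) : R) ^ k := by
        rw [MonoidAlgebra.single_pow, one_pow]
      rw [h1, map_pow, ← hc, hJ, Ideal.mem_span_singleton]
      exact sub_dvd_pow_sub_pow _ _ k
    have hpJ : algebraMap ℤ_[p] R ((p : ℤ_[p]) ^ (n + 1)) ∈ J := by
      obtain ⟨w, ⟨wu, rfl⟩, hw⟩ := den_aux_unit p n u hu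
      have h2 := hpow (Nat.totient (p ^ (n + 1)))
      rw [ZMod.pow_totient, hc, ← map_sub] at h2
      have h3 : (p : ℤ_[p]) ^ (n + 1) =
          (1 - (u : ℤ_[p]) ^ (Nat.totient (p ^ (n + 1)))) * (-((wu⁻¹ : ℤ_[p]ˣ) : ℤ_[p])) := by
        have : (1 - (u : ℤ_[p]) ^ (Nat.totient (p ^ (n + 1)))) =
          -((p : ℤ_[p]) ^ (n + 1) * wu) := by rw [← hw]; ring
        rw [this, neg_mul_neg, mul_assoc, Units.mul_inv, mul_one]
      rw [h3, map_mul]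
      exact J.mul_mem_right _ h2
    have hvU : v ∈ Subgroup.zpowers U := by
      rw [hU, hu (n + 1) (by omega)]; trivial
    obtain ⟨k, rfl : U ^ k = v⟩ := mem_powers_iff_mem_zpowers.2 hvU
    have h4 := den_aux_mem p (n + 1) J hpJ ((u : ℤ_[p]) ^ k) (a : ℤ_[p]) (by
      rw [map_pow, map_intCast, ← hv, Units.val_pow_eq_pow_val, hUval])
    have h5 := J.add_mem (hpow k) h4
    rw [sub_add_sub_cancel, ← hci] at h5
    exact h5
  · rw [Ideal.span_le, Set.singleton_subset_iff, SetLike.mem_coe]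
    set I := Ideal.span {x : R |
        ∃ (a : ℤ) (v : (ZMod (p ^ (n + 1)))ˣ),
          IsCoprime a (2 * (p : ℤ)) ∧ ((v : ZMod (p ^ (n + 1))) = (a : ZMod (p ^ (n + 1)))) ∧
            x = MonoidAlgebra.single v 1 - (a : R)} with hI
    have hpz : ((p : ZMod (p ^ (n + 1))) ^ (n + 1)) = 0 := by
      exact_mod_cast ZMod.natCast_self (p ^ (n + 1))
    have h2u : IsUnit (2 : ℤ_[p]) := by
      have : IsUnit ((2 : ℕ) : ℤ_[p]) := by
        rw [PadicInt.isUnit_iff, PadicInt.norm_natCast_eq_one_iff]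
        exact hodd.coprime_two_right
      simpa using this
    have hpI : algebraMap ℤ_[p] R ((p : ℤ_[p]) ^ (n + 1)) ∈ I := by
      have h1 : (MonoidAlgebra.single 1 1 - ((1 + 2 * (p : ℤ) ^ (n + 1) : ℤ) : R)) ∈ I := by
        apply Ideal.subset_span
        refine ⟨_, 1, ⟨1, -(p : ℤ) ^ n, by ring⟩, ?_, rfl⟩
        push_cast
        rw [hpz]; simp
      rw [hci, hc, ← map_sub] at h1
      obtain ⟨t, ht⟩ := h2u
      have h3 : (p : ℤ_[p]) ^ (n + 1) =
          (1 - ((1 + 2 * (p : ℤ) ^ (n + 1) : ℤ) : ℤ_[p])) * (-((t⁻¹ : ℤ_[p]ˣ) : ℤ_[p])) := by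
        push_cast
        rw [← ht]
        linear_combination (-(p : ℤ_[p]) ^ (n + 1)) * t.mul_inv
      rw [h3, map_mul]
      exact I.mul_mem_right _ h1
    obtain ⟨a, ha2, haU⟩ : ∃ a : ℤ, Odd a ∧ (a : ZMod (p ^ (n + 1))) = U := by
      obtain ⟨b, hb⟩ := ZMod.intCast_surjective (U : ZMod (p ^ (n + 1)))
      rcases Int.even_or_odd b with h | h
      · refine ⟨b + (p : ℤ) ^ (n + 1), h.add_odd ?_, ?_⟩
        · exact Odd.pow (by exact_mod_cast hodd)
        · push_cast; rw [hpz, hb, add_zero]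
      · exact ⟨b, h, hb⟩
    have hap : IsCoprime a (p : ℤ) := by
      have h1 : IsUnit ((a : ℤ) : ZMod (p ^ (n + 1))) := haU ▸ U.isUnit
      have h2 := (ZMod.coe_int_isUnit_iff_isCoprime a (p ^ (n + 1))).1 h1
      push_cast at h2
      exact ((IsCoprime.pow_left_iff (Nat.succ_pos n)).1 h2).symm
    have ha : IsCoprime a (2 * (p : ℤ)) := by
      refine IsCoprime.mul_right ?_ hap
      obtain ⟨m, hm⟩ := ha2
      exact ⟨1, -m, by rw [hm]; ring⟩
    have h1 : (MonoidAlgebra.single U 1 - (a : R)) ∈ I :=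
      Ideal.subset_span ⟨a, U, ha, haU.symm, rfl⟩
    have h4 := den_aux_mem p (n + 1) I hpI (a : ℤ_[p]) (u : ℤ_[p]) (by
      rw [map_intCast, haU, hUval])
    have h5 := I.add_mem h1 h4
    rw [hci, sub_add_sub_cancel, ← hc] at h5
    exact h5
end

section
/- Let p be an odd prime, n ≥ 0 an integer, G = (ℤ/p^{n+1}ℤ)ˣ, and let θ_n ∈ ℚ_p[G] be the Stickelberger element. Let u ∈ ℤ_pˣ be a topological generator of ℤ_pˣ and ū its image in G. Then ([ū] − u)·θ_n lies in ℤ_p[G], and the ℤ_p-span of the Stickelberger ideal, namely the set { θ_n·y : y ∈ ℤ_p[G] and θ_n·y ∈ ℤ_p[G] }, is equal to the principal ideal of ℤ_p[G] generated by ([ū] − u)·θ_n. -/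
open MonoidAlgebra in
theorem incl_single (p : ℕ) [Fact p.Prime] (n : ℕ) (g : (ZMod (p ^ (n + 1)))ˣ) (c : ℤ_[p]) :
    groupRingIncl p n (single g c) = single g (c : ℚ_[p]) := by
  unfold groupRingIncl
  simp [MonoidAlgebra.liftNCRingHom, MonoidAlgebra.single_mul_single]
  rfl

open MonoidAlgebra in
theorem stick_half (p : ℕ) [Fact p.Prime] (hodd : Odd p) : ∃ h : ℤ_[p], 2 * h = 1 := by
  have : IsUnit ((2:ℕ) : ℤ_[p]) := by
    rw [PadicInt.isUnit_iff, PadicInt.norm_natCast_eq_one_iff]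
    exact hodd.coprime_two_right
  obtain ⟨h, hh⟩ := this.exists_right_inv
  exact ⟨h, by simpa using hh⟩

theorem toZ_zero (p : ℕ) [Fact p.Prime] (k : ℕ) (c : ℤ_[p])
    (h : PadicInt.toZModPow (p := p) k c = 0) : ∃ d, c = (p:ℤ_[p])^k * d := by
  have : c ∈ RingHom.ker (PadicInt.toZModPow (p := p) k) := h
  rw [PadicInt.ker_toZModPow, Ideal.mem_span_singleton] at this
  exact this

open MonoidAlgebra in
theorem stick_integral (p : ℕ) [Fact p.Prime] (hodd : Odd p) (n : ℕ)
    (u : ℤ_[p]ˣ) :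
    ∃ t : MonoidAlgebra ℤ_[p] (ZMod (p ^ (n + 1)))ˣ,
      groupRingIncl p n t =
        (MonoidAlgebra.single
            (Units.map (PadicInt.toZModPow (p := p) (n + 1)).toMonoidHom u) (1 : ℚ_[p]) -
          MonoidAlgebra.single 1 (((u : ℤ_[p]) : ℚ_[p]))) * padicStickelberger p n := by
  obtain ⟨h, hh⟩ := stick_half p hodd
  have hh' : (1/2 : ℚ_[p]) = (h : ℚ_[p]) := by
    have : (2:ℚ_[p]) * (h:ℚ_[p]) = 1 := by exact_mod_cast congrArg (fun x : ℤ_[p] => (x:ℚ_[p])) hh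
    linear_combination -(1/2) * this
  have hp : (p:ℚ_[p]) ≠ 0 := by exact_mod_cast (Fact.out : p.Prime).ne_zero
  set v := Units.map (PadicInt.toZModPow (p := p) (n + 1)).toMonoidHom u with hv
  have key : ∀ b : (ZMod (p ^ (n + 1)))ˣ, ∃ d : ℤ_[p],
      (u:ℤ_[p]) * ((b : ZMod (p ^ (n + 1))).val : ℤ_[p]) -
        (((v * b : (ZMod (p ^ (n + 1)))ˣ) : ZMod (p ^ (n + 1))).val : ℤ_[p]) = (p:ℤ_[p])^(n+1) * d := by
    intro b
    apply toZ_zero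
    simp [hv]
  choose d hd using key
  refine ⟨∑ b, single b⁻¹ (d b + h - u * h), ?_⟩
  have e : ∀ f : (ZMod (p ^ (n + 1)))ˣ → MonoidAlgebra ℚ_[p] (ZMod (p ^ (n + 1)))ˣ,
    ∑ a, f a = ∑ b, f (v * b) := fun f => (Equiv.sum_comp (Equiv.mulLeft v) f).symm
  rw [padicStickelberger, mul_neg, sub_mul, Finset.mul_sum, Finset.mul_sum, e (fun a => single v 1 * _),
    ← Finset.sum_sub_distrib, ← Finset.sum_neg_distrib, map_sum]
  refine Finset.sum_congr rfl fun b _ => ?_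
  rw [incl_single, single_mul_single, single_mul_single, mul_inv, mul_inv_cancel_left, one_mul (b⁻¹), ← single_sub, ← single_neg]
  congr 1
  have h1 := congrArg (fun x : ℤ_[p] => (x:ℚ_[p])) (hd b)
  push_cast at h1 ⊢
  rw [hh']
  have h2 : (d b : ℚ_[p]) = ((u:ℤ_[p]) * ((b : ZMod (p ^ (n + 1))).val : ℚ_[p]) -
        ((v * b : ZMod (p ^ (n + 1))).val : ℚ_[p])) / p^(n+1) := by
    rw [h1]; field_simp
  rw [h2]; ring

/-- the generator of `J` -/
noncomputable def stickS (p : ℕ) [Fact p.Prime] (n : ℕ) (u : ℤ_[p]ˣ) :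
    MonoidAlgebra ℤ_[p] (ZMod (p ^ (n + 1)))ˣ :=
  MonoidAlgebra.single (Units.map (PadicInt.toZModPow (p := p) (n + 1)).toMonoidHom u) 1 -
    MonoidAlgebra.single 1 (u : ℤ_[p])

open MonoidAlgebra in
theorem stickS_pow (p : ℕ) [Fact p.Prime] (n : ℕ) (u : ℤ_[p]ˣ) (k : ℕ) :
    stickS p n u ∣ single ((Units.map (PadicInt.toZModPow (p := p) (n + 1)).toMonoidHom u)^k) 1 -
      single 1 ((u : ℤ_[p])^k) := by
  have := sub_dvd_pow_sub_pow (single (Units.map (PadicInt.toZModPow (p := p) (n + 1)).toMonoidHom u) (1:ℤ_[p]))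
    (single 1 (u : ℤ_[p])) k
  rwa [single_pow, single_pow, one_pow, one_pow] at this

open MonoidAlgebra in
theorem stick_const (p : ℕ) [Fact p.Prime] (n : ℕ) (u : ℤ_[p]ˣ)
    (hu : Subgroup.zpowers (Units.map (PadicInt.toZModPow (p := p) (n+1)).toMonoidHom u) = ⊤)
    (y : MonoidAlgebra ℤ_[p] (ZMod (p ^ (n + 1)))ˣ) :
    ∃ c : ℤ_[p], stickS p n u ∣ y - single 1 c := by
  induction y using MonoidAlgebra.induction_linear with
  | zero => exact ⟨0, by simp⟩
  | add f g hf hg =>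
    obtain ⟨a, ha⟩ := hf
    obtain ⟨b, hb⟩ := hg
    refine ⟨a + b, ?_⟩
    rw [single_add, add_sub_add_comm]
    exact dvd_add ha hb
  | single g r =>
    have hg : g ∈ Subgroup.zpowers (Units.map (PadicInt.toZModPow (p := p) (n+1)).toMonoidHom u) := by
      rw [hu]; trivial
    rw [← mem_powers_iff_mem_zpowers] at hg
    obtain ⟨k, rfl⟩ := hg
    refine ⟨r * (u:ℤ_[p])^k, ?_⟩
    have := (stickS_pow p n u k).mul_left (single 1 r)
    rwa [mul_sub, single_mul_single, single_mul_single, one_mul, one_mul, mul_one] at this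

open MonoidAlgebra in
theorem stick_N (p : ℕ) [Fact p.Prime] (hodd : Odd p) (n : ℕ) (u : ℤ_[p]ˣ)
    (hu : ∀ k : ℕ, 1 ≤ k →
      Subgroup.zpowers (Units.map (PadicInt.toZModPow (p := p) k).toMonoidHom u) = ⊤) :
    stickS p n u ∣ single 1 ((p:ℤ_[p])^(n+1)) := by
  have hpp : p.Prime := Fact.out
  set m := Nat.totient (p^(n+1)) with hm
  have ho : ∀ k, 1 ≤ k → orderOf (Units.map (PadicInt.toZModPow (p := p) k).toMonoidHom u) = Nat.totient (p^k) := by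
    intro k hk
    have : NeZero (p^k) := ⟨pow_ne_zero _ hpp.ne_zero⟩
    rw [← ZMod.card_units_eq_totient, ← Nat.card_eq_fintype_card]
    exact orderOf_eq_card_of_zpowers_eq_top (hu k hk)
  have h1 : (Units.map (PadicInt.toZModPow (p := p) (n+1)).toMonoidHom u)^m = 1 := by
    rw [hm, ← ho (n+1) (by omega)]; exact pow_orderOf_eq_one _
  have h2 : (Units.map (PadicInt.toZModPow (p := p) (n+2)).toMonoidHom u)^m ≠ 1 := by
    intro h
    have := Nat.le_of_dvd (Nat.totient_pos.2 (pow_pos hpp.pos _)) (orderOf_dvd_of_pow_eq_one h)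
    rw [ho (n+2) (by omega), Nat.totient_prime_pow_succ hpp, Nat.totient_prime_pow_succ hpp] at this
    have h3 := Nat.le_of_mul_le_mul_right this (Nat.sub_pos_of_lt hpp.one_lt)
    exact absurd h3 (not_le.2 (Nat.pow_lt_pow_right hpp.one_lt (by omega)))
  obtain ⟨d, hd⟩ := toZ_zero p (n+1) ((u:ℤ_[p])^m - 1) (by
    have := congrArg Units.val h1
    simp at this
    simp [this])
  have hdu : IsUnit d := by
    by_contra hc
    have : d ∈ IsLocalRing.maximalIdeal ℤ_[p] := hc
    rw [PadicInt.maximalIdeal_eq_span_p, Ideal.mem_span_singleton] at this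
    obtain ⟨e, rfl⟩ := this
    apply h2
    ext1
    have h4 := congrArg (PadicInt.toZModPow (p := p) (n+2)) hd
    have h5 : ((p:ℤ_[p])^(n+1) * (p * e)) = p^(n+2) * e := by ring
    have h6 : PadicInt.toZModPow (p := p) (n+2) ((p:ℤ_[p])^(n+2)) = 0 := by
      rw [map_pow, map_natCast]; exact_mod_cast ZMod.natCast_self _
    rw [h5, map_mul, h6, zero_mul, map_sub, map_pow, map_one, sub_eq_zero] at h4
    simpa using h4
  obtain ⟨e, he⟩ := hdu.exists_right_inv
  have := (stickS_pow p n u m).mul_left (single 1 (-e))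
  rw [h1, ← single_sub, single_mul_single, one_mul] at this
  convert this using 2
  linear_combination (-(p:ℤ_[p])^(n+1)) * he - e * hd

/-- reduction `ℤ_p[G] → ℤ/p^{n+1}` sending `[a]` to `a` -/
noncomputable def stickPhi (p : ℕ) [Fact p.Prime] (n : ℕ) :
    MonoidAlgebra ℤ_[p] (ZMod (p ^ (n + 1)))ˣ →+* ZMod (p ^ (n + 1)) :=
  MonoidAlgebra.liftNCRingHom (PadicInt.toZModPow (p := p) (n + 1))
    (Units.coeHom _) (fun _ _ => Commute.all _ _)

open MonoidAlgebra in
theorem stickPhi_single (p : ℕ) [Fact p.Prime] (n : ℕ) (g : (ZMod (p ^ (n + 1)))ˣ) (c : ℤ_[p]) :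
    stickPhi p n (single g c) = PadicInt.toZModPow (p := p) (n + 1) c * g := by
  simp [stickPhi, MonoidAlgebra.liftNCRingHom]

theorem stickPhi_S (p : ℕ) [Fact p.Prime] (n : ℕ) (u : ℤ_[p]ˣ) : stickPhi p n (stickS p n u) = 0 := by
  rw [stickS, map_sub, stickPhi_single, stickPhi_single]
  simp

open MonoidAlgebra in
theorem incl_apply (p : ℕ) [Fact p.Prime] (n : ℕ) (y : MonoidAlgebra ℤ_[p] (ZMod (p ^ (n + 1)))ˣ)
    (g : (ZMod (p ^ (n + 1)))ˣ) : (groupRingIncl p n y).coeff g = ((y.coeff g : ℤ_[p]) : ℚ_[p]) := by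
  classical
  induction y using MonoidAlgebra.induction_linear with
  | zero => simp
  | add f g hf hg => simp [hf, hg]
  | single a r => 
    rw [incl_single]
    by_cases h : a = g <;> simp [Finsupp.single_apply, h]

open MonoidAlgebra in
theorem stick_phi_zero (p : ℕ) [Fact p.Prime] (hodd : Odd p) (n : ℕ)
    (x y : MonoidAlgebra ℤ_[p] (ZMod (p ^ (n + 1)))ˣ)
    (hxy : groupRingIncl p n x = padicStickelberger p n * groupRingIncl p n y) :
    stickPhi p n y = 0 := by
  obtain ⟨h, hh⟩ := stick_half p hodd
  have hh' : (1/2 : ℚ_[p]) = (h : ℚ_[p]) := by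
    have : (2:ℚ_[p]) * (h:ℚ_[p]) = 1 := by exact_mod_cast congrArg (fun x : ℤ_[p] => (x:ℚ_[p])) hh
    linear_combination -(1/2) * this
  have hp : (p:ℚ_[p]) ≠ 0 := by exact_mod_cast (Fact.out : p.Prime).ne_zero
  have hy : y = ∑ a, single a (y.coeff a) := by
    ext g
    simp [Finsupp.single_apply, coeff_sum, Finset.sum_apply']
  have h1 := congrArg (fun z => z.coeff 1) hxy
  simp only [incl_apply] at h1
  rw [padicStickelberger, neg_mul, Finset.sum_mul, coeff_neg, coeff_sum, Finsupp.neg_apply, Finset.sum_apply'] at h1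
  have h2 : (∑ a : (ZMod (p ^ (n + 1)))ˣ, ((a : ZMod (p ^ (n + 1))).val : ℤ_[p]) * y.coeff a) =
      p^(n+1) * (h * ∑ a, y.coeff a - x.coeff 1) := by
    apply Subtype.coe_injective
    push_cast
    rw [h1, hh']
    simp only [coeff_single_mul_apply, incl_apply, inv_inv, mul_one, sub_mul, Finset.sum_sub_distrib, ← Finset.mul_sum]
    have : ∀ a : (ZMod (p ^ (n + 1)))ˣ, ((a : ZMod (p ^ (n + 1))).val : ℚ_[p]) / p^(n+1) * (y.coeff a : ℚ_[p])
      = (p^(n+1) : ℚ_[p])⁻¹ * (((a : ZMod (p ^ (n + 1))).val : ℚ_[p]) * (y.coeff a : ℚ_[p])) := by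
      intro a; ring
    simp only [this, ← Finset.mul_sum]
    have c1 : ∀ f : (ZMod (p ^ (n + 1)))ˣ → ℤ_[p], ((∑ a, f a : ℤ_[p]) : ℚ_[p]) = ∑ a, (f a : ℚ_[p]) :=
      fun f => map_sum (PadicInt.Coe.ringHom (p := p)) f _
    rw [c1, c1]
    push_cast
    field_simp
    ring
  have h3 := congrArg (PadicInt.toZModPow (p := p) (n+1)) h2
  have h6 : PadicInt.toZModPow (p := p) (n+1) ((p:ℤ_[p])^(n+1)) = 0 := by
    rw [map_pow, map_natCast]; exact_mod_cast ZMod.natCast_self _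
  rw [map_mul, h6, zero_mul, map_sum] at h3
  rw [hy, map_sum, ← h3]
  refine Finset.sum_congr rfl fun a _ => ?_
  rw [stickPhi_single, map_mul, map_natCast, ZMod.natCast_zmod_val, mul_comm]

theorem incl_inj (p : ℕ) [Fact p.Prime] (n : ℕ) : Function.Injective (groupRingIncl p n) := by
  intro x y h
  ext g
  have := congrArg (fun z => z.coeff g) h
  simp only [incl_apply] at this
  exact Subtype.coe_injective this

/-- Let `p` be an odd prime, `n ≥ 0`, `G = (ℤ/p^{n+1}ℤ)ˣ`, `θ_n ∈ ℚ_p[G]` the Stickelberger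
element and `u ∈ ℤ_pˣ` a topological generator of `ℤ_pˣ`, with image `ū ∈ G`.  Then
`([ū] - u)·θ_n` lies in `ℤ_p[G]`, and the ℤ_p-span of the Stickelberger ideal,
`{ θ_n·y : y ∈ ℤ_p[G], θ_n·y ∈ ℤ_p[G] }`, is the principal ideal of `ℤ_p[G]` generated by
`([ū] - u)·θ_n`. -/
theorem stickelberger_span_principal (p : ℕ) [Fact p.Prime] (hodd : Odd p) (n : ℕ)
    (u : ℤ_[p]ˣ)
    (hu : ∀ k : ℕ, 1 ≤ k →
      Subgroup.zpowers (Units.map (PadicInt.toZModPow (p := p) k).toMonoidHom u) = ⊤) :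
    ∃ t : MonoidAlgebra ℤ_[p] (ZMod (p ^ (n + 1)))ˣ,
      groupRingIncl p n t =
        (MonoidAlgebra.single
            (Units.map (PadicInt.toZModPow (p := p) (n + 1)).toMonoidHom u) (1 : ℚ_[p]) -
          MonoidAlgebra.single 1 (((u : ℤ_[p]) : ℚ_[p]))) * padicStickelberger p n ∧
      ∀ x : MonoidAlgebra ℤ_[p] (ZMod (p ^ (n + 1)))ˣ,
        (∃ y : MonoidAlgebra ℤ_[p] (ZMod (p ^ (n + 1)))ˣ,
            groupRingIncl p n x = padicStickelberger p n * groupRingIncl p n y)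
          ↔ x ∈ Ideal.span {t} := by
  have hs : groupRingIncl p n (stickS p n u) = MonoidAlgebra.single
            (Units.map (PadicInt.toZModPow (p := p) (n + 1)).toMonoidHom u) (1 : ℚ_[p]) -
          MonoidAlgebra.single 1 (((u : ℤ_[p]) : ℚ_[p])) := by
    rw [stickS, map_sub, incl_single, incl_single]; simp
  obtain ⟨t, ht⟩ := stick_integral p hodd n u
  refine ⟨t, ht, fun x => ?_⟩
  rw [← hs] at ht
  rw [Ideal.mem_span_singleton]
  constructor
  · rintro ⟨y, hxy⟩
    have hy := stick_phi_zero p hodd n x y hxy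
    obtain ⟨c, hc⟩ := stick_const p n u (hu (n+1) (by omega)) y
    have hc0 : PadicInt.toZModPow (p := p) (n + 1) c = 0 := by
      obtain ⟨z, hz⟩ := hc
      have := congrArg (stickPhi p n) hz
      rw [map_mul, stickPhi_S, zero_mul, map_sub, hy, stickPhi_single] at this
      simpa using this
    obtain ⟨d, rfl⟩ := toZ_zero p (n+1) c hc0
    have h1 := (stick_N p hodd n u hu).mul_right (MonoidAlgebra.single 1 d)
    rw [MonoidAlgebra.single_mul_single, one_mul] at h1
    obtain ⟨z, hz⟩ := (dvd_sub_left h1).1 hc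
    refine ⟨z, incl_inj p n ?_⟩
    rw [hxy, hz, map_mul, map_mul, ht]
    ring
  · rintro ⟨z, rfl⟩
    refine ⟨stickS p n u * z, ?_⟩
    rw [map_mul, map_mul, ht]
    ring
end

section
/- Let p be an odd prime, m ≥ 1 an integer, and f' ≥ 2 an integer with p ∤ f'; set f = p^m·f'. Let D ⊆ (ℤ/fℤ)ˣ be the set of units a whose reduction modulo f' is a power of p, i.e. a ≡ p^k (mod f') for some integer k ≥ 0. Then ∏_{a∈D} (1 − exp(2πi·ã/f)) = 1. -/
open scoped Classical

lemma aux_split (g : ℕ → ℂ) (A k : ℕ) :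
    ∏ x ∈ Finset.range (A * k), g x = ∏ j ∈ Finset.range k, ∏ y ∈ Finset.range A, g (A * j + y) := by
  induction k with
  | zero => simp
  | succ k ih => rw [Nat.mul_succ, Finset.prod_range_add, ih, Finset.prod_range_succ]

lemma aux_root (p : ℕ) (hp : 0 < p) (z a : ℂ) (hz : IsPrimitiveRoot z p) :
    ∏ j ∈ Finset.range p, (1 - z ^ j * a) = 1 - a ^ p := by
  have h := hz.pow_sub_pow_eq_prod_sub_mul 1 a hp
  rw [one_pow] at h
  rw [h]
  refine Finset.prod_nbij (fun j => z ^ j) ?_ ?_ ?_ (fun _ _ => rfl)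
  · intro j _
    rw [Polynomial.mem_nthRootsFinset hp, ← pow_mul, mul_comm, pow_mul, hz.pow_eq_one, one_pow]
  · intro i hi j hj hij
    exact hz.pow_inj (by simpa using hi) (by simpa using hj) hij
  · intro w hw
    have hw : w ^ p = 1 := (Polynomial.mem_nthRootsFinset hp _).1 (by simpa using hw)
    haveI : NeZero p := ⟨hp.ne'⟩
    obtain ⟨i, hi, rfl⟩ := hz.eq_pow_of_pow_eq_one hw
    exact ⟨i, by simpa using hi, rfl⟩

/-- exp(2πi x / N) -/
noncomputable def ee (N x : ℕ) : ℂ := Complex.exp (2 * (Real.pi : ℂ) * Complex.I * (x : ℂ) / (N : ℂ))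

lemma ee_eq (N x : ℕ) : ee N x = Complex.exp (2 * (Real.pi : ℂ) * Complex.I / (N : ℂ)) ^ x := by
  rw [ee, ← Complex.exp_nat_mul]; congr 1; ring

lemma ee_ne (N x : ℕ) (hN : 0 < N) (h : ¬ N ∣ x) : 1 - ee N x ≠ 0 := by
  intro h1
  rw [ee_eq] at h1
  exact h ((Complex.isPrimitiveRoot_exp N hN.ne').dvd_of_pow_eq_one x (sub_eq_zero.1 h1).symm)

lemma ee_scale (p N x : ℕ) (hp : 0 < p) : ee (p * N) (p * x) = ee N x := by
  unfold ee
  congr 1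
  have : (p : ℂ) ≠ 0 := by exact_mod_cast hp.ne'
  push_cast
  rw [show 2 * (Real.pi : ℂ) * Complex.I * (p * x) = p * (2 * (Real.pi : ℂ) * Complex.I * x) by ring,
    mul_div_mul_left _ _ this]

lemma ee_add (p N j y : ℕ) (hN : 0 < N) :
    ee (p * N) (N * j + y) = Complex.exp (2 * (Real.pi : ℂ) * Complex.I / (p : ℂ)) ^ j * ee (p * N) y := by
  rw [ee_eq (p * N) (N * j + y), pow_add, ← ee_eq, ← ee_eq, ← ee_eq, mul_comm p N, ee_scale N p j hN]

lemma ee_pow (p N y : ℕ) (hp : 0 < p) : ee (p * N) y ^ p = ee N y := by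
  rw [ee_eq, ← pow_mul, ← ee_eq, mul_comm y p, ee_scale p N y hp]

lemma aux_norm (p N : ℕ) (hp : 0 < p) (hN : 0 < N) (Q : ℕ → Prop)
    (hQ : ∀ j y, Q (N * j + y) ↔ Q y) :
    ∏ x ∈ Finset.range (p * N), (if Q x then 1 - ee (p * N) x else 1) =
    ∏ x ∈ Finset.range N, (if Q x then 1 - ee N x else 1) := by
  conv_lhs => rw [mul_comm p N, aux_split, mul_comm N p]
  rw [Finset.prod_comm]
  refine Finset.prod_congr rfl fun y _ => ?_
  simp only [hQ]
  split_ifs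
  · simp only [ee_add p N _ _ hN]
    rw [aux_root p hp _ _ (Complex.isPrimitiveRoot_exp p hp.ne'), ee_pow p N y hp]
  · simp

lemma aux_dvd (p N : ℕ) (hp : 0 < p) (Q : ℕ → Prop) (hQ : ∀ y, Q (p * y) ↔ Q y) :
    ∏ x ∈ Finset.range (p * N), (if Q x ∧ p ∣ x then 1 - ee (p * N) x else 1) =
    ∏ x ∈ Finset.range N, (if Q x then 1 - ee N x else 1) := by
  rw [aux_split]
  refine Finset.prod_congr rfl fun y _ => ?_
  rw [Finset.prod_eq_single_of_mem 0 (by simpa using hp)]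
  · simp [hQ, ee_scale p N y hp]
  · intro b hb hb0
    rw [if_neg]
    rintro ⟨-, h⟩
    have := Nat.le_of_dvd (Nat.pos_of_ne_zero hb0) ((Nat.dvd_add_right (dvd_mul_right p y)).1 h)
    simp at hb; omega

lemma aux_main (p N : ℕ) (hp : 0 < p) (hN : 0 < N) (Q : ℕ → Prop)
    (hQ1 : ∀ j y, Q (N * j + y) ↔ Q y) (hQ : ∀ y, Q (p * y) ↔ Q y) (h0 : ¬ Q 0) :
    ∏ x ∈ Finset.range (p * N), (if Q x ∧ ¬ p ∣ x then 1 - ee (p * N) x else 1) = 1 := by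
  have h1 := aux_norm p N hp hN Q hQ1
  rw [← aux_dvd p N hp Q hQ] at h1
  have hne : ∏ x ∈ Finset.range (p * N), (if Q x ∧ p ∣ x then 1 - ee (p * N) x else 1) ≠ 0 := by
    rw [Finset.prod_ne_zero_iff]
    intro x hx
    split_ifs with h
    · apply ee_ne _ _ (by positivity)
      intro hd
      have : x = 0 := Nat.eq_zero_of_dvd_of_lt hd (by simpa using hx)
      exact h0 (this ▸ h.1)
    · exact one_ne_zero
  apply mul_right_cancel₀ hne
  rw [one_mul]
  rw [← Finset.prod_mul_distrib]
  refine Eq.trans ?_ h1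
  refine Finset.prod_congr rfl fun x _ => ?_
  by_cases hq : Q x <;> by_cases hd : p ∣ x <;> simp [hq, hd]

/-- Let `p` be an odd prime, `m ≥ 1`, and `f' ≥ 2` with `p ∤ f'`; set `f = p^m·f'`.  Let
`D ⊆ (ℤ/fℤ)ˣ` be the set of units whose reduction modulo `f'` is a power of `p` (the
decomposition group of `p` in `Gal(ℚ(μ_f)/ℚ)`).  Then `∏_{a ∈ D} (1 - exp(2πi·ã/f)) = 1`. -/
theorem prod_one_sub_root_of_unity_over_decomposition_group
    (p m f' : ℕ) (hp : p.Prime) (hodd : Odd p) (hm : 1 ≤ m) (hf' : 2 ≤ f')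
    (hpf' : ¬ p ∣ f') :
    haveI : NeZero (p ^ m * f') := ⟨Nat.mul_ne_zero (pow_ne_zero m hp.ne_zero) (by omega)⟩
    ∏ a ∈ Finset.univ.filter (fun a : (ZMod (p ^ m * f'))ˣ =>
        ∃ k : ℕ, ZMod.castHom (dvd_mul_left f' (p ^ m)) (ZMod f') (a : ZMod (p ^ m * f'))
          = (p : ZMod f') ^ k),
      (1 - Complex.exp (2 * (Real.pi : ℂ) * Complex.I *
        (((a : ZMod (p ^ m * f')).val : ℂ)) / ((p ^ m * f' : ℕ) : ℂ)))
    = 1 := by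
  haveI : NeZero (p ^ m * f') := ⟨Nat.mul_ne_zero (pow_ne_zero m hp.ne_zero) (by omega)⟩
  haveI : NeZero f' := ⟨by omega⟩
  haveI : Fact (1 < f') := ⟨hf'⟩
  have hcop : p.Coprime f' := (Nat.Prime.coprime_iff_not_dvd hp).2 hpf'
  have hu : IsUnit (p : ZMod f') := (ZMod.isUnit_iff_coprime p f').2 hcop
  obtain ⟨n, rfl⟩ : ∃ n, m = n + 1 := ⟨m - 1, by omega⟩
  have hN : p ^ (n + 1) * f' = p * (p ^ n * f') := by ring
  have key := aux_main p (p ^ n * f') hp.pos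
    (Nat.mul_pos (pow_pos hp.pos n) (by omega)) (fun x => ∃ k : ℕ, (x : ZMod f') = (p : ZMod f') ^ k)
    (by intro j y; simp) (by
      intro y
      constructor
      · rintro ⟨k, hk⟩
        refine ⟨k + (f'.totient - 1), ?_⟩
        have ht : (p : ZMod f') ^ f'.totient = 1 := by
          have := ZMod.pow_totient (ZMod.unitOfCoprime p hcop)
          have h2 := congrArg Units.val this
          rwa [Units.val_pow_eq_pow_val, ZMod.coe_unitOfCoprime, Units.val_one] at h2
        have h1 : 0 < f'.totient := Nat.totient_pos.2 (by omega)
        apply hu.mul_left_cancel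
        rw [pow_add, mul_left_comm, ← pow_succ', Nat.sub_add_cancel h1, ht, mul_one, ← hk]
        push_cast; rfl
      · rintro ⟨k, hk⟩
        exact ⟨k + 1, by push_cast; rw [hk, pow_succ']⟩) (by
      rintro ⟨k, hk⟩
      have := hu.pow k
      rw [← hk] at this
      simp at this)
  rw [← hN, ← Finset.prod_filter] at key
  refine Eq.trans ?_ key
  refine Finset.prod_nbij (fun a => (a : ZMod (p ^ (n + 1) * f')).val) ?_ ?_ ?_ (fun _ _ => rfl)
  · intro a ha
    simp only [Finset.mem_filter, Finset.mem_univ, true_and, Finset.mem_range] at ha ⊢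
    refine ⟨ZMod.val_lt _, ?_, ?_⟩
    · obtain ⟨k, hk⟩ := ha
      exact ⟨k, by rw [← hk, ZMod.castHom_apply, ZMod.natCast_val]⟩
    · intro hd
      have := ZMod.val_coe_unit_coprime a
      have h2 : p ∣ p ^ (n + 1) * f' := hN ▸ dvd_mul_right _ _
      exact hp.one_lt.ne' (Nat.dvd_one.1 (this ▸ Nat.dvd_gcd hd h2))
  · intro a _ b _ hab
    exact Units.ext (ZMod.val_injective _ hab)
  · intro x hx
    simp only [Finset.coe_filter, Set.mem_setOf_eq, Finset.mem_range] at hx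
    obtain ⟨hlt, ⟨k, hk⟩, hd⟩ := hx
    have hxu : IsUnit (x : ZMod f') := hk ▸ hu.pow k
    have hc : x.Coprime (p ^ (n + 1) * f') :=
      Nat.Coprime.mul_right (((Nat.Prime.coprime_iff_not_dvd hp).2 hd).symm.pow_right _)
        ((ZMod.isUnit_iff_coprime x f').1 hxu)
    refine ⟨ZMod.unitOfCoprime x hc, ?_, ?_⟩
    · simp only [Finset.coe_filter, Finset.mem_univ, true_and, Set.mem_setOf_eq]
      exact ⟨k, by rw [ZMod.coe_unitOfCoprime, map_natCast, hk]⟩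
    · simp only [ZMod.coe_unitOfCoprime]
      exact ZMod.val_natCast_of_lt hlt
end

section
/- Let p and r be distinct prime numbers, let G be a finite commutative group, and let g ∈ G. Then the element 1 − r⁻¹·g of the group ring ℤ_p[G] is not a zero divisor, where r⁻¹ denotes the inverse in ℤ_p of the image of r (which is a unit of ℤ_p since r ≠ p). -/
/-- Let `p` and `r` be distinct primes, `G` a finite commutative group and `g ∈ G`.  Then
`1 - r⁻¹·g` is not a zero divisor in the group ring `ℤ_p[G]` (here `r⁻¹ = Ring.inverse r` is
the inverse in `ℤ_p` of the image of `r`, which is a unit of `ℤ_p` since `r ≠ p`). -/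
theorem one_sub_inv_prime_smul_group_elt_nonZeroDivisor
    (p r : ℕ) [Fact p.Prime] (hr : r.Prime) (hpr : p ≠ r)
    (G : Type*) [CommGroup G] [Fintype G] (g : G) :
    (1 : MonoidAlgebra ℤ_[p] G) - MonoidAlgebra.single g (Ring.inverse (r : ℤ_[p]))
      ∈ nonZeroDivisors (MonoidAlgebra ℤ_[p] G) := by
  have hu : IsUnit (r : ℤ_[p]) := by
    rw [PadicInt.isUnit_iff, PadicInt.norm_def]
    have := (Padic.norm_natCast_eq_one_iff (p := p) (n := r))
    simp only [PadicInt.coe_natCast]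
    first
      | exact this.2 ((Nat.coprime_primes Fact.out hr).2 hpr)
      | exact this.2 ((Nat.coprime_primes hr Fact.out).2 hpr.symm)
  set u := Ring.inverse (r : ℤ_[p]) with hudef
  have hur : u * r = 1 := Ring.inverse_mul_cancel _ hu
  set n := Fintype.card G with hn
  have hn0 : n ≠ 0 := Fintype.card_ne_zero
  have hun : u ^ n ≠ 1 := by
    intro h
    have h1 : u ^ n * (r : ℤ_[p]) ^ n = 1 := by rw [← mul_pow, hur, one_pow]
    rw [h, one_mul] at h1
    have h2 : r ^ n = 1 := by exact_mod_cast h1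
    exact (Nat.one_lt_pow hn0 hr.one_lt).ne' h2
  rw [mem_nonZeroDivisors_iff_right]
  intro x hx
  have h1 : x * MonoidAlgebra.single g u = x := by
    rw [mul_sub, mul_one, sub_eq_zero] at hx
    exact hx.symm
  have h2 : ∀ k : ℕ, x * MonoidAlgebra.single g u ^ k = x := by
    intro k
    induction k with
    | zero => simp
    | succ k ih => rw [pow_succ, ← mul_assoc, ih, h1]
  have h3 := h2 n
  rw [MonoidAlgebra.single_pow, hn, pow_card_eq_one, ← hn] at h3
  ext a
  have h4 : x.coeff a * u ^ n = x.coeff a := by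
    rw [← MonoidAlgebra.coeff_mul_single_one, h3]
  have h5 : x.coeff a * (u ^ n - 1) = 0 := by rw [mul_sub, h4, mul_one, sub_self]
  exact (mul_eq_zero.1 h5).resolve_right (sub_ne_zero.2 hun)
end
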